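/- For integers d ≥ 3 and q ≥ 1 with m = dq, the set W = {(i, j) ∈ (Z/mZ)² : i ≡ j (mod q)} has exactly m·d elements, and the polytope P_{d,q} = conv{f(i,j) : (i,j) ∈ W}, with f(a,b) = (1/√2)(cos(2πa/m), sin(2πa/m), cos(2πb/m), sin(2πb/m)), has exactly m(m − d + 2) facets, consisting of m vertical facets, m horizontal facets, and md(q−1) diagonal tetrahedra. -/

import Mathlib

noncomputable section

open Real

/-- The point of `ℝ⁴` (as Euclidean space) with the given four coordinates. -/
def pt (x y z w : ℝ) : EuclideanSpace ℝ (Fin 4) :=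
  (WithLp.equiv 2 (Fin 4 → ℝ)).symm ![x, y, z, w]

/-- The parametrization of the standard torus of `S³` on `(ℤ/mℤ)²`:
`f(a,b) = (1/√2)(cos(2πa/m), sin(2πa/m), cos(2πb/m), sin(2πb/m))`. -/
def fpt (m : ℕ) (a b : ZMod m) : EuclideanSpace ℝ (Fin 4) :=
  pt ((1 / Real.sqrt 2) * Real.cos (2 * π * a.val / m))
     ((1 / Real.sqrt 2) * Real.sin (2 * π * a.val / m))
     ((1 / Real.sqrt 2) * Real.cos (2 * π * b.val / m))
     ((1 / Real.sqrt 2) * Real.sin (2 * π * b.val / m))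

/-- The (affine) dimension of a subset of `ℝ⁴`. -/
def polyDim (S : Set (EuclideanSpace ℝ (Fin 4))) : ℕ :=
  Module.finrank ℝ (affineSpan ℝ S).direction

/-- A facet of a polytope `P`: a proper nonempty exposed face of dimension one
less than `P`. -/
def IsFacet (P F : Set (EuclideanSpace ℝ (Fin 4))) : Prop :=
  IsExposed ℝ P F ∧ F ≠ P ∧ F.Nonempty ∧ polyDim F + 1 = polyDim P

open scoped NNReal

local notation "ℝ⁴" => EuclideanSpace ℝ (Fin 4)

theorem convexHull_face {S : Set ℝ⁴} {l : ℝ⁴ →L[ℝ] ℝ} {c : ℝ} (hle : ∀ x ∈ S, l x ≤ c) :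
    convexHull ℝ {x ∈ S | l x = c} = {x ∈ convexHull ℝ S | l x = c} := by
  apply Set.Subset.antisymm
  · apply convexHull_min
    · exact fun x hx => ⟨subset_convexHull ℝ S hx.1, hx.2⟩
    · exact (convex_convexHull ℝ S).inter (convex_hyperplane l.toLinearMap.isLinear c)
  · have key : convexHull ℝ S ⊆ {x | l x ≤ c ∧ (l x = c → x ∈ convexHull ℝ {x ∈ S | l x = c})} := by
      apply convexHull_min
      · exact fun x hx => ⟨hle x hx, fun h => subset_convexHull ℝ _ ⟨hx, h⟩⟩
      · rw [convex_iff_forall_pos]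
        rintro x ⟨hx, hx'⟩ y ⟨hy, hy'⟩ a b ha hb hab
        simp only [Set.mem_ofPred_eq, map_add, map_smul, smul_eq_mul]
        have h1 := mul_le_mul_of_nonneg_left hx ha.le
        have h2 := mul_le_mul_of_nonneg_left hy hb.le
        have h3 : a * c + b * c = c := by rw [← add_mul, hab, one_mul]
        refine ⟨by linarith, fun h => ?_⟩
        have h4 : l x = c := mul_left_cancel₀ ha.ne' (by linarith)
        have h5 : l y = c := mul_left_cancel₀ hb.ne' (by linarith)
        exact convex_convexHull ℝ _ (hx' h4) (hy' h5) ha.le hb.le hab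
    exact fun x hx => (key hx.1).2 hx.2

theorem le_of_mem_convexHull {S : Set ℝ⁴} {l : ℝ⁴ →L[ℝ] ℝ} {c : ℝ} (hle : ∀ x ∈ S, l x ≤ c)
    {x : ℝ⁴} (hx : x ∈ convexHull ℝ S) : l x ≤ c :=
  convexHull_min (t := {x | l x ≤ c}) hle (convex_halfSpace_le l.toLinearMap.isLinear c) hx

theorem polyDim_convexHull (S : Set ℝ⁴) : polyDim (convexHull ℝ S) =
    Module.finrank ℝ (vectorSpan ℝ S) := by
  rw [polyDim, affineSpan_convexHull, direction_affineSpan]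

theorem finrank_vectorSpan_face {T : Set ℝ⁴} {l : ℝ⁴ →L[ℝ] ℝ} {c : ℝ} (hc : 0 < c)
    (hT : ∀ x ∈ T, l x = c) {v : Fin 4 → ℝ⁴} (hv : LinearIndependent ℝ v) (hvT : ∀ n, v n ∈ T) :
    Module.finrank ℝ (vectorSpan ℝ T) = 3 ∧ vectorSpan ℝ T ≤ LinearMap.ker l.toLinearMap := by
  have hker : vectorSpan ℝ T ≤ LinearMap.ker l.toLinearMap := by
    rw [vectorSpan_def, Submodule.span_le]
    rintro _ ⟨x, hx, y, hy, rfl⟩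
    simp [hT x hx, hT y hy]
  refine ⟨le_antisymm ?_ ?_, hker⟩
  · have hne : LinearMap.ker l.toLinearMap ≠ ⊤ := by
      intro h
      have : v 0 ∈ LinearMap.ker l.toLinearMap := h ▸ Submodule.mem_top
      have h0 := hT _ (hvT 0)
      simp at this
      linarith
    have h1 := Submodule.finrank_lt (lt_top_iff_ne_top.2 hne).ne
    have h2 := Submodule.finrank_mono hker
    rw [finrank_euclideanSpace_fin] at h1
    omega
  · have h1 := hv.affineIndependent.finrank_vectorSpan (n := 3) (by simp)
    rw [← h1]
    exact Submodule.finrank_mono (vectorSpan_mono ℝ (Set.range_subset_iff.2 hvT))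

theorem isFacet_face {S : Set ℝ⁴} {l : ℝ⁴ →L[ℝ] ℝ} {c : ℝ} (hc : 0 < c)
    (hle : ∀ x ∈ S, l x ≤ c) {v : Fin 4 → ℝ⁴} (hv : LinearIndependent ℝ v)
    (hvS : ∀ n, v n ∈ S ∧ l (v n) = c) {z : ℝ⁴} (hz : z ∈ S) (hzc : l z < c) :
    IsFacet (convexHull ℝ S) (convexHull ℝ {x ∈ S | l x = c}) := by
  have hv0 := hvS 0
  refine ⟨fun _ => ⟨l, ?_⟩, ?_, ?_, ?_⟩
  · rw [convexHull_face hle]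
    ext x
    refine and_congr_right fun hx => ⟨fun h y hy => h ▸ le_of_mem_convexHull hle hy, fun h => ?_⟩
    exact le_antisymm (le_of_mem_convexHull hle hx) (hv0.2 ▸ h _ (subset_convexHull ℝ S hv0.1))
  · intro h
    have : z ∈ convexHull ℝ {x ∈ S | l x = c} := h ▸ subset_convexHull ℝ S hz
    rw [convexHull_face hle] at this
    exact hzc.ne this.2
  · exact ⟨v 0, subset_convexHull ℝ _ hv0⟩
  · rw [polyDim_convexHull, polyDim_convexHull]
    obtain ⟨h1, h2⟩ := finrank_vectorSpan_face (T := {x ∈ S | l x = c}) hc (fun x hx => hx.2) hv hvS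
    have hlt : vectorSpan ℝ {x ∈ S | l x = c} < vectorSpan ℝ S := by
      refine lt_of_le_of_ne (vectorSpan_mono ℝ (Set.sep_subset _ _)) fun h => ?_
      have h3 : z - v 0 ∈ vectorSpan ℝ S := vsub_mem_vectorSpan ℝ hz hv0.1
      have h4 := h2 (h ▸ h3)
      simp at h4
      linarith [hv0.2]
    have h5 := Submodule.finrank_lt_finrank_of_lt hlt
    have h6 := Submodule.finrank_le (vectorSpan ℝ S)
    rw [finrank_euclideanSpace_fin] at h6
    omega

theorem le_of_mem_cone {T : Set ℝ⁴} {f g : ℝ⁴ →L[ℝ] ℝ} (h : ∀ x ∈ T, f x ≤ g x)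
    {x : ℝ⁴} (hx : x ∈ Submodule.span ℝ≥0 T) : f x ≤ g x := by
  induction hx using Submodule.span_induction with
  | mem x hx => exact h x hx
  | zero => simp
  | add x y _ _ hx hy => simpa using add_le_add hx hy
  | smul a x _ hx => simpa [NNReal.smul_def] using mul_le_mul_of_nonneg_left hx a.2

/-- If the cones over the faces cut out by the functionals `l i` cover the space, then these faces
are exactly the facets. -/
theorem isFacet_iff_of_cover {ι : Type*} {S : Set ℝ⁴} (hS : S.Finite)
    {l : ι → ℝ⁴ →L[ℝ] ℝ} {c : ℝ} (hc : 0 < c) (hle : ∀ i, ∀ x ∈ S, l i x ≤ c)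
    (hind : ∀ i, ∃ v : Fin 4 → ℝ⁴, LinearIndependent ℝ v ∧ ∀ n, v n ∈ S ∧ l i (v n) = c)
    (hcover : ∀ x, ∃ i, x ∈ Submodule.span ℝ≥0 {x ∈ S | l i x = c}) (F : Set ℝ⁴) :
    IsFacet (convexHull ℝ S) F ↔ ∃ i, convexHull ℝ {x ∈ S | l i x = c} = F := by
  have hfacet : ∀ i, IsFacet (convexHull ℝ S) (convexHull ℝ {x ∈ S | l i x = c}) := by
    intro i
    obtain ⟨v, hv, hvS⟩ := hind i
    by_cases hz : ∃ z ∈ S, l i z < c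
    · obtain ⟨z, hz, hzc⟩ := hz
      exact isFacet_face hc (hle i) hv hvS hz hzc
    · push Not at hz
      obtain ⟨j, hj⟩ := hcover (-v 0)
      have := le_of_mem_cone (f := 0) (g := l i) (fun x hx => by
        simpa using hc.le.trans (hz x hx.1)) hj
      simp [(hvS 0).2] at this
      linarith
  constructor
  · rintro ⟨hexp, hne, hnon, hdim⟩
    obtain ⟨f, hf⟩ := hexp hnon
    obtain ⟨x₀, hx₀⟩ := hnon
    have hx₀' := hx₀
    rw [hf] at hx₀'
    have hfle : ∀ x ∈ S, f x ≤ f x₀ := fun x hx => hx₀'.2 x (subset_convexHull ℝ S hx)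
    have hF : F = {x ∈ convexHull ℝ S | f x = f x₀} := by
      rw [hf]
      ext x
      refine and_congr_right fun hx => ⟨fun h => ?_, fun h y hy => h ▸ hx₀'.2 y hy⟩
      exact le_antisymm (hx₀'.2 x hx) (h x₀ hx₀'.1)
    have hpos : 0 < f x₀ := by
      by_contra! hneg
      have hall : ∀ x, f x ≤ 0 := fun x => by
        obtain ⟨i, hi⟩ := hcover x
        exact le_of_mem_cone (f := f) (g := 0) (fun y hy => (hfle y hy.1).trans hneg) hi
      have hzero : ∀ x, f x = 0 := fun x => le_antisymm (hall x) (by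
        have := hall (-x); rw [map_neg] at this; linarith)
      exact hne (by rw [hF]; ext x; simp [hzero])
    have hFM : F = convexHull ℝ {x ∈ S | f x = f x₀} := by rw [hF, convexHull_face hfle]
    have hMfin : {x ∈ S | f x = f x₀}.Finite := hS.subset (Set.sep_subset _ _)
    obtain ⟨i, hi⟩ := hcover (∑ y ∈ hMfin.toFinset, y)
    have hM : ∀ y ∈ hMfin.toFinset, y ∈ S ∧ f y = f x₀ := fun y hy => by simpa using hy
    have h1 := le_of_mem_cone (f := c • f) (g := f x₀ • l i) (fun x hx => by
      simpa [hx.2, mul_comm] using mul_le_mul_of_nonneg_left (hfle x hx.1) hc.le) hi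
    have h2 : ∀ y ∈ hMfin.toFinset, l i y ≤ c := fun y hy => hle i y (hM y hy).1
    have h3 : ∀ y ∈ hMfin.toFinset, l i y = c := by
      rw [← Finset.sum_eq_sum_iff_of_le h2]
      refine le_antisymm (Finset.sum_le_sum h2) ?_
      simp only [smul_apply, map_sum, smul_eq_mul, ← Finset.mul_sum] at h1
      rw [Finset.sum_congr rfl fun y hy => (hM y hy).2] at h1
      simp only [Finset.sum_const, nsmul_eq_mul] at h1 ⊢
      refine le_of_mul_le_mul_left ?_ hpos
      linarith
    have hsub : F ⊆ convexHull ℝ {x ∈ S | l i x = c} := by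
      rw [hFM]
      exact convexHull_mono fun y hy => ⟨hy.1, h3 y (by simpa using hy)⟩
    refine ⟨i, Set.Subset.antisymm ?_ hsub⟩
    have hspan : affineSpan ℝ F = affineSpan ℝ (convexHull ℝ {x ∈ S | l i x = c}) := by
      refine AffineSubspace.eq_of_direction_eq_of_nonempty_of_le ?_ ⟨x₀, subset_affineSpan ℝ F hx₀⟩
        (affineSpan_mono ℝ hsub)
      refine Submodule.eq_of_le_of_finrank_eq
        (AffineSubspace.direction_le (affineSpan_mono ℝ hsub)) ?_
      have := (hfacet i).2.2.2
      unfold polyDim at this hdim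
      omega
    intro x hx
    have hxF : x ∈ affineSpan ℝ F := hspan ▸ subset_affineSpan ℝ _ hx
    rw [hF]
    refine ⟨convexHull_mono (Set.sep_subset _ _) hx, ?_⟩
    have hd : x - x₀ ∈ (affineSpan ℝ F).direction :=
      AffineSubspace.vsub_mem_direction hxF (subset_affineSpan ℝ F hx₀)
    have hk : (affineSpan ℝ F).direction ≤ LinearMap.ker f.toLinearMap := by
      rw [direction_affineSpan, vectorSpan_def, Submodule.span_le]
      rintro _ ⟨y, hy, z, hz, rfl⟩
      rw [hF] at hy hz
      simp [hy.2, hz.2]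
    have := hk hd
    simpa [sub_eq_zero] using this
  · rintro ⟨i, rfl⟩
    exact hfacet i

theorem ncard_facets_of_cover {ι : Type*} [Fintype ι] {S : Set ℝ⁴} (hS : S.Finite)
    {l : ι → ℝ⁴ →L[ℝ] ℝ} {c : ℝ} (hc : 0 < c) (hle : ∀ i, ∀ x ∈ S, l i x ≤ c)
    (hind : ∀ i, ∃ v : Fin 4 → ℝ⁴, LinearIndependent ℝ v ∧ ∀ n, v n ∈ S ∧ l i (v n) = c)
    (hcover : ∀ x, ∃ i, x ∈ Submodule.span ℝ≥0 {x ∈ S | l i x = c})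
    (hinj : Function.Injective fun i => {x ∈ S | l i x = c}) :
    {F | IsFacet (convexHull ℝ S) F}.ncard = Fintype.card ι := by
  have hinj' : Function.Injective fun i => convexHull ℝ {x ∈ S | l i x = c} := by
    intro i j hij
    have key : ∀ i, S ∩ convexHull ℝ {x ∈ S | l i x = c} = {x ∈ S | l i x = c} := fun i => by
      rw [convexHull_face (hle i)]
      ext x
      exact ⟨fun h => ⟨h.1, h.2.2⟩, fun h => ⟨h.1, subset_convexHull ℝ S h.1, h.2⟩⟩
    apply hinj
    simp only at hij ⊢
    rw [← key i, ← key j, hij]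
  have : {F | IsFacet (convexHull ℝ S) F} =
      Set.range fun i => convexHull ℝ {x ∈ S | l i x = c} := by
    ext F
    exact isFacet_iff_of_cover hS hc hle hind hcover F
  rw [this, ← Nat.card_coe_set_eq, Nat.card_range_of_injective hinj', Nat.card_eq_fintype_card]

theorem cos_le_cos_of_mem_Icc {a x : ℝ} (ha : 0 ≤ a) (h1 : a ≤ x) (h2 : x ≤ 2 * π - a) :
    Real.cos x ≤ Real.cos a := by
  rcases le_total x π with h | h
  · exact Real.cos_le_cos_of_nonneg_of_le_pi ha h h1
  · rw [← Real.cos_two_pi_sub x]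
    exact Real.cos_le_cos_of_nonneg_of_le_pi ha (by linarith) (by linarith)

theorem cos_add_int_mul {m : ℕ} {θ : ℝ} (hθ : m * θ = π) (x : ℝ) (u : ℤ) :
    Real.cos (x + 2 * (m * u) * θ) = Real.cos x := by
  rw [← Real.cos_add_int_mul_two_pi x u, ← hθ]
  ring_nf

theorem cos_odd_le {m : ℕ} (hm : 3 ≤ m) {θ : ℝ} (hθ : m * θ = π) (s : ℤ) :
    Real.cos ((2 * s - 1) * θ) ≤ Real.cos θ := by
  have hm0 : (0 : ℤ) < m := by omega
  have hθ0 : 0 < θ := by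
    have h : 0 < m * θ := hθ ▸ Real.pi_pos
    exact pos_of_mul_pos_right h (by positivity)
  have h1 := Int.emod_nonneg (s - 1) hm0.ne'
  have h2 := Int.emod_lt_of_pos (s - 1) hm0
  have h3 := Int.emod_add_mul_ediv (s - 1) m
  set r := (s - 1) % (m : ℤ)
  set u := (s - 1) / (m : ℤ)
  have hs : (s : ℝ) = r + 1 + m * u := by
    have : s = r + 1 + m * u := by linarith
    exact_mod_cast this
  have h1' : (0 : ℝ) ≤ r := by exact_mod_cast h1
  have h2' : (r : ℝ) + 1 ≤ m := by exact_mod_cast h2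
  have : (2 * (s : ℝ) - 1) * θ = (2 * r + 1) * θ + 2 * (m * u) * θ := by rw [hs]; ring
  rw [this, cos_add_int_mul hθ]
  apply cos_le_cos_of_mem_Icc hθ0.le
  · nlinarith
  · rw [← hθ]
    nlinarith

theorem cos_odd_eq_iff {m : ℕ} {θ : ℝ} (hθ : m * θ = π) (s : ℤ) :
    Real.cos ((2 * s - 1) * θ) = Real.cos θ ↔ (m : ℤ) ∣ s ∨ (m : ℤ) ∣ s - 1 := by
  have hθ0 : θ ≠ 0 := by
    rintro rfl
    simp at hθ
    exact Real.pi_ne_zero hθ.symm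
  constructor
  · intro h
    obtain ⟨k, hk⟩ := Real.cos_eq_cos_iff.1 h
    rw [← hθ] at hk
    rcases hk with hk | hk
    · have h1 : (1 : ℝ) = 2 * k * m + (2 * s - 1) := mul_right_cancel₀ hθ0 (by linarith)
      have h2 : (1 : ℤ) = 2 * k * m + (2 * s - 1) := by exact_mod_cast h1
      exact Or.inr ⟨-k, by linarith⟩
    · have h1 : (1 : ℝ) = 2 * k * m - (2 * s - 1) := mul_right_cancel₀ hθ0 (by linarith)
      have h2 : (1 : ℤ) = 2 * k * m - (2 * s - 1) := by exact_mod_cast h1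
      exact Or.inl ⟨k, by linarith⟩
  · rintro (⟨u, hu⟩ | ⟨u, hu⟩)
    · have : (s : ℝ) = m * u := by exact_mod_cast hu
      rw [← Real.cos_neg θ, ← cos_add_int_mul hθ (-θ) u, this]
      ring_nf
    · have : (s : ℝ) = m * u + 1 := by
        have : s = m * u + 1 := by linarith
        exact_mod_cast this
      rw [← cos_add_int_mul hθ θ u, this]
      ring_nf

/-- The value, up to normalization, at the lattice point `(X, Y)` of the functional supporting the
facet with parameter `k` based at the origin. -/
def facetVal (θ : ℝ) (q k X Y : ℤ) : ℝ :=
  Real.sin (k * θ) * Real.cos ((2 * X - q + k - 1) * θ) +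
    Real.sin ((q - k) * θ) * Real.cos ((2 * Y + k - 1) * θ)

theorem sin_mul_cos_sub_add (u v o : ℝ) :
    Real.sin u * Real.cos (o - v) + Real.sin v * Real.cos (o + u) =
      Real.sin (u + v) * Real.cos o := by
  rw [Real.cos_sub, Real.cos_add, Real.sin_add]
  ring

theorem facetVal_far_lt {θ u v T n : ℝ} (hθ : 0 < θ) (hu : θ ≤ u) (hv : θ ≤ v)
    (huv : u + v ≤ π / 3) (hT : 3 * (u + v) ≤ T) (hT' : T ≤ 2 * π - 3 * (u + v)) :
    Real.sin u * Real.cos (n + T) + Real.sin v * Real.cos n <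
      Real.sin (u + v) * Real.cos θ := by
  have hpi := Real.pi_pos
  have hsθ : 0 < Real.sin θ := Real.sin_pos_of_pos_of_lt_pi hθ (by linarith)
  have hsu : Real.sin θ ≤ Real.sin u :=
    Real.sin_le_sin_of_le_of_le_pi_div_two (by linarith) (by linarith) hu
  have hsv : Real.sin θ ≤ Real.sin v :=
    Real.sin_le_sin_of_le_of_le_pi_div_two (by linarith) (by linarith) hv
  have hcθ : 0 < Real.cos θ := Real.cos_pos_of_mem_Ioo ⟨by linarith, by linarith⟩
  have hsuv : 0 < Real.sin (u + v) :=
    Real.sin_pos_of_pos_of_lt_pi (by linarith) (by linarith)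
  have hcuv : 1 / 2 ≤ Real.cos (u + v) := by
    rw [← Real.cos_pi_div_three]
    exact Real.cos_le_cos_of_nonneg_of_le_pi (by linarith) (by linarith) huv
  have hcT : Real.cos T ≤ Real.cos (3 * (u + v)) :=
    cos_le_cos_of_mem_Icc (by linarith) hT hT'
  have h1 : (Real.sin u * Real.cos (n + T) + Real.sin v * Real.cos n) ^ 2 ≤
      Real.sin u ^ 2 + Real.sin v ^ 2 + 2 * Real.sin u * Real.sin v * Real.cos T := by
    have e1 := Real.sin_sq_add_cos_sq n
    have e2 := Real.sin_sq_add_cos_sq T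
    rw [Real.cos_add]
    have : Real.sin u ^ 2 + Real.sin v ^ 2 + 2 * Real.sin u * Real.sin v * Real.cos T -
      (Real.sin u * (Real.cos n * Real.cos T - Real.sin n * Real.sin T) +
        Real.sin v * Real.cos n) ^ 2 =
      (Real.sin u * (Real.sin n * Real.cos T + Real.cos n * Real.sin T) +
        Real.sin v * Real.sin n) ^ 2 := by
      linear_combination (-Real.sin u ^ 2 * (Real.sin T ^ 2 + Real.cos T ^ 2) - Real.sin v ^ 2
        - 2 * Real.sin u * Real.sin v * Real.cos T) * e1 - Real.sin u ^ 2 * e2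
    nlinarith [sq_nonneg (Real.sin u * (Real.sin n * Real.cos T + Real.cos n * Real.sin T) +
        Real.sin v * Real.sin n)]
  have h2 : Real.sin (u + v) ^ 2 = Real.sin u ^ 2 + Real.sin v ^ 2 +
      2 * Real.sin u * Real.sin v * Real.cos (u + v) := by
    rw [Real.cos_add, Real.sin_add]
    linear_combination Real.sin u ^ 2 * Real.sin_sq_add_cos_sq v +
      Real.sin v ^ 2 * Real.sin_sq_add_cos_sq u
  have h3 : Real.cos (u + v) - Real.cos (3 * (u + v)) =
      4 * Real.sin (u + v) ^ 2 * Real.cos (u + v) := by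
    rw [Real.cos_three_mul]
    linear_combination -4 * Real.cos (u + v) * Real.sin_sq_add_cos_sq (u + v)
  have h4 : Real.sin θ ^ 2 ≤ Real.sin u * Real.sin v := by nlinarith
  have h5 : Real.sin (u + v) ^ 2 * Real.sin θ ^ 2 <
      2 * (Real.sin u * Real.sin v) * (Real.cos (u + v) - Real.cos T) := by
    have h6 : 2 * Real.sin (u + v) ^ 2 ≤ Real.cos (u + v) - Real.cos T := by
      nlinarith [sq_nonneg (Real.sin (u + v))]
    have h7 : 0 < Real.sin (u + v) ^ 2 := by positivity
    have h8 : 0 < Real.sin θ ^ 2 := by positivity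
    nlinarith [mul_le_mul h4 h6 (by positivity) (by nlinarith), mul_pos h7 h8]
  refine lt_of_pow_lt_pow_left₀ 2 (by positivity) ?_
  rw [mul_pow]
  nlinarith [Real.sin_sq_add_cos_sq θ]

theorem facetVal_zero (θ : ℝ) (q X Y : ℤ) :
    facetVal θ q 0 X Y = Real.sin (q * θ) * Real.cos ((2 * Y - 1) * θ) := by
  simp [facetVal]

theorem facetVal_self (θ : ℝ) (q X Y : ℤ) :
    facetVal θ q q X Y = Real.sin (q * θ) * Real.cos ((2 * X - 1) * θ) := by
  simp [facetVal]

section FacetVal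

variable {d q m : ℕ} {θ : ℝ}

theorem sin_facet_pos (hd : 3 ≤ d) (hq : 1 ≤ q) (hm : m = d * q) (hθ : m * θ = π) :
    0 < Real.sin (q * θ) := by
  subst hm
  push_cast at hθ
  have hd' : (3 : ℝ) ≤ d := by exact_mod_cast hd
  have hq' : (1 : ℝ) ≤ q := by exact_mod_cast hq
  have h : 0 < (q : ℝ) * θ := by
    refine pos_of_mul_pos_right (a := (d : ℝ)) ?_ (by positivity)
    rw [← mul_assoc, hθ]
    exact Real.pi_pos
  exact Real.sin_pos_of_pos_of_lt_pi h (by nlinarith)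

theorem facetVal_interior (hd : 3 ≤ d) (hm : m = d * q) (hθ : m * θ = π)
    {k : ℤ} (hk : 0 < k) (hkq : k < q) {X Y : ℤ} (hXY : (q : ℤ) ∣ X - Y) :
    facetVal θ q k X Y ≤ Real.sin (q * θ) * Real.cos θ ∧
    (facetVal θ q k X Y = Real.sin (q * θ) * Real.cos θ ↔
      ((m : ℤ) ∣ X ∧ (m : ℤ) ∣ Y) ∨ ((m : ℤ) ∣ X - 1 ∧ (m : ℤ) ∣ Y - 1) ∨
      ((m : ℤ) ∣ X - (q - k) ∧ (m : ℤ) ∣ Y + k) ∨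
      ((m : ℤ) ∣ X - (q - k) - 1 ∧ (m : ℤ) ∣ Y + k - 1)) := by
  have hq : 1 ≤ q := by omega
  have hm3 : 3 ≤ m := by rw [hm]; nlinarith
  have hs := sin_facet_pos hd hq hm hθ
  obtain ⟨t, ht⟩ := hXY
  have hd0 : (0 : ℤ) < d := by omega
  have hq0 : (0 : ℤ) < q := by omega
  have ht1 := Int.emod_nonneg t hd0.ne'
  have ht2 := Int.emod_lt_of_pos t hd0
  have ht3 := Int.emod_add_mul_ediv t d
  set r := t % (d : ℤ)
  set u := t / (d : ℤ)
  have hmZ : (m : ℤ) = d * q := by exact_mod_cast hm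
  have hX : X = Y + q * r + m * u := by rw [hmZ]; linear_combination ht - q * ht3
  have hval : facetVal θ q k X Y = Real.sin (k * θ) * Real.cos ((2 * Y + k - 1) * θ +
      (2 * r - 1) * (q * θ)) + Real.sin ((q - k) * θ) * Real.cos ((2 * Y + k - 1) * θ) := by
    rw [facetVal, hX, ← cos_add_int_mul hθ ((2 * Y + k - 1) * θ + (2 * r - 1) * (q * θ)) u]
    push_cast
    ring_nf
  have hdr : ∀ e : ℤ, (m : ℤ) ∣ q * r - q * e → (d : ℤ) ∣ r - e := by
    rintro e ⟨w, hw⟩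
    refine ⟨w, mul_left_cancel₀ hq0.ne' ?_⟩
    rw [hmZ] at hw
    linear_combination hw
  have hRHS0 : (m : ℤ) ∣ X - Y → r = 0 := by
    rintro ⟨w, hw⟩
    have h0 := hdr 0 ⟨w - u, by linear_combination hw - hX⟩
    exact Int.eq_zero_of_dvd_of_nonneg_of_lt ht1 ht2 (by simpa using h0)
  have hRHS1 : (m : ℤ) ∣ X - Y - q → r = 1 := by
    rintro ⟨w, hw⟩
    have h0 := hdr 1 ⟨w - u, by linear_combination hw - hX⟩
    obtain ⟨w', hw'⟩ := h0
    have : w' = 0 := by nlinarith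
    subst this
    linarith
  by_cases hr0 : r = 0
  · have hv : facetVal θ q k X Y = Real.sin (q * θ) * Real.cos ((2 * Y - 1) * θ) := by
      have := sin_mul_cos_sub_add (k * θ) ((q - k) * θ) ((2 * Y - 1) * θ)
      rw [hval, hr0]
      convert this using 3 <;> push_cast <;> ring_nf
    have hX' : X = Y + m * u := by rw [hX, hr0]; ring
    rw [hv]
    refine ⟨mul_le_mul_of_nonneg_left (cos_odd_le hm3 hθ Y) hs.le, ?_⟩
    rw [mul_right_inj' hs.ne', cos_odd_eq_iff hθ]
    constructor
    · rintro (h | h)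
      · exact Or.inl ⟨by rw [hX']; exact Int.dvd_add h (Int.dvd_mul_right _ _), h⟩
      · refine Or.inr (Or.inl ⟨?_, h⟩)
        rw [hX', add_sub_right_comm]
        exact Int.dvd_add h (Int.dvd_mul_right _ _)
    · rintro (h | h | h | h)
      · exact Or.inl h.2
      · exact Or.inr h.2
      · exact absurd (hRHS1 (by convert Int.dvd_sub h.1 h.2 using 1; ring)) (by omega)
      · exact absurd (hRHS1 (by convert Int.dvd_sub h.1 h.2 using 1; ring)) (by omega)
  by_cases hr1 : r = 1
  · have hv : facetVal θ q k X Y = Real.sin (q * θ) * Real.cos ((2 * (Y + k : ℤ) - 1) * θ) := by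
      have := sin_mul_cos_sub_add ((q - k) * θ) (k * θ) ((2 * (Y + k) - 1) * θ)
      rw [hval, hr1, add_comm]
      convert this using 3 <;> push_cast <;> ring_nf
    have hX' : X = Y + q + m * u := by rw [hX, hr1]; ring
    rw [hv]
    refine ⟨mul_le_mul_of_nonneg_left (cos_odd_le hm3 hθ _) hs.le, ?_⟩
    rw [mul_right_inj' hs.ne', cos_odd_eq_iff hθ]
    constructor
    · rintro (h | h)
      · refine Or.inr (Or.inr (Or.inl ⟨?_, h⟩))
        convert Int.dvd_add h (Int.dvd_mul_right m u) using 1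
        rw [hX']; ring
      · refine Or.inr (Or.inr (Or.inr ⟨?_, h⟩))
        convert Int.dvd_add h (Int.dvd_mul_right m u) using 1
        rw [hX']; ring
    · rintro (h | h | h | h)
      · exact absurd (hRHS0 (Int.dvd_sub h.1 h.2)) hr0
      · exact absurd (hRHS0 (by convert Int.dvd_sub h.1 h.2 using 1; ring)) hr0
      · exact Or.inl h.2
      · exact Or.inr h.2
  · have hlt : facetVal θ q k X Y < Real.sin (q * θ) * Real.cos θ := by
      have hθ0 : 0 < θ := by
        have h : 0 < m * θ := hθ ▸ Real.pi_pos
        exact pos_of_mul_pos_right h (by positivity)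
      have hmR : (m : ℝ) = d * q := by exact_mod_cast hm
      have hk1 : (1 : ℝ) ≤ k := by exact_mod_cast hk
      have hk2 : (k : ℝ) + 1 ≤ q := by exact_mod_cast hkq
      have hr2 : (2 : ℝ) ≤ r := by
        have : 2 ≤ r := by omega
        exact_mod_cast this
      have hr3 : (r : ℝ) + 1 ≤ d := by exact_mod_cast ht2
      have hd3 : (3 : ℝ) ≤ d := by exact_mod_cast hd
      have hpi : π = d * (q * θ) := by rw [← hθ, hmR]; ring
      have hqθ : 0 < q * θ := by positivity
      have hsum : k * θ + (q - k) * θ = q * θ := by ring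
      rw [hval, ← hsum]
      apply facetVal_far_lt hθ0
      · nlinarith
      · nlinarith
      · rw [hsum, hpi]; nlinarith
      · rw [hsum]; nlinarith
      · rw [hsum, hpi]; nlinarith
    refine ⟨hlt.le, iff_of_false hlt.ne ?_⟩
    rintro (h | h | h | h)
    · exact hr0 (hRHS0 (Int.dvd_sub h.1 h.2))
    · exact hr0 (hRHS0 (by convert Int.dvd_sub h.1 h.2 using 1; ring))
    · exact hr1 (hRHS1 (by convert Int.dvd_sub h.1 h.2 using 1; ring))
    · exact hr1 (hRHS1 (by convert Int.dvd_sub h.1 h.2 using 1; ring))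

theorem facetVal_le (hd : 3 ≤ d) (hq : 1 ≤ q) (hm : m = d * q) (hθ : m * θ = π)
    {k : ℤ} (hk : 0 ≤ k) (hkq : k ≤ q) {X Y : ℤ} (hXY : (q : ℤ) ∣ X - Y) :
    facetVal θ q k X Y ≤ Real.sin (q * θ) * Real.cos θ := by
  have hm3 : 3 ≤ m := by rw [hm]; nlinarith
  have hs := sin_facet_pos hd hq hm hθ
  rcases hk.eq_or_lt with rfl | hk
  · rw [facetVal_zero]
    exact mul_le_mul_of_nonneg_left (cos_odd_le hm3 hθ Y) hs.le
  rcases hkq.eq_or_lt with rfl | hkq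
  · rw [facetVal_self]
    exact mul_le_mul_of_nonneg_left (cos_odd_le hm3 hθ X) hs.le
  exact (facetVal_interior hd hm hθ hk hkq hXY).1

theorem facetVal_zero_eq_iff (hd : 3 ≤ d) (hq : 1 ≤ q) (hm : m = d * q) (hθ : m * θ = π)
    (X Y : ℤ) : facetVal θ q 0 X Y = Real.sin (q * θ) * Real.cos θ ↔
      (m : ℤ) ∣ Y ∨ (m : ℤ) ∣ Y - 1 := by
  rw [facetVal_zero, Int.cast_natCast, mul_right_inj' (sin_facet_pos hd hq hm hθ).ne',
    cos_odd_eq_iff hθ]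

theorem facetVal_self_eq_iff (hd : 3 ≤ d) (hq : 1 ≤ q) (hm : m = d * q) (hθ : m * θ = π)
    (X Y : ℤ) : facetVal θ q q X Y = Real.sin (q * θ) * Real.cos θ ↔
      (m : ℤ) ∣ X ∨ (m : ℤ) ∣ X - 1 := by
  rw [facetVal_self, Int.cast_natCast, mul_right_inj' (sin_facet_pos hd hq hm hθ).ne',
    cos_odd_eq_iff hθ]

theorem facetVal_corners (q k : ℤ) :
    facetVal θ q k 0 0 = Real.sin (q * θ) * Real.cos θ ∧
    facetVal θ q k 1 1 = Real.sin (q * θ) * Real.cos θ ∧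
    facetVal θ q k (q - k) (-k) = Real.sin (q * θ) * Real.cos θ ∧
    facetVal θ q k (q - k + 1) (-k + 1) = Real.sin (q * θ) * Real.cos θ := by
  have e : (k : ℝ) * θ + (q - k) * θ = q * θ := by ring
  have e' : ((q : ℝ) - k) * θ + k * θ = q * θ := by ring
  refine ⟨?_, ?_, ?_, ?_⟩ <;> unfold facetVal
  · have := sin_mul_cos_sub_add (k * θ) ((q - k) * θ) (-θ)
    rw [Real.cos_neg, e] at this
    rw [← this]; push_cast; ring_nf
  · have := sin_mul_cos_sub_add (k * θ) ((q - k) * θ) θ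
    rw [e] at this
    rw [← this]; push_cast; ring_nf
  · have := sin_mul_cos_sub_add ((q - k) * θ) (k * θ) (-θ)
    rw [Real.cos_neg, e'] at this
    rw [← this]; push_cast; ring_nf
  · have := sin_mul_cos_sub_add ((q - k) * θ) (k * θ) θ
    rw [e'] at this
    rw [← this]; push_cast; ring_nf

end FacetVal

/-- The point of the unit circle at angle `x`. -/
def rot (x : ℝ) : ℂ := Complex.exp (x * Complex.I)

theorem rot_re (x : ℝ) : (rot x).re = Real.cos x := Complex.exp_ofReal_mul_I_re x

theorem rot_im (x : ℝ) : (rot x).im = Real.sin x := Complex.exp_ofReal_mul_I_im x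

theorem rot_add (x y : ℝ) : rot (x + y) = rot x * rot y := by
  rw [rot, rot, rot, ← Complex.exp_add]
  push_cast
  ring_nf

theorem rot_zero : rot 0 = 1 := by simp [rot]

theorem conj_rot (x : ℝ) : (starRingEnd ℂ) (rot x) = rot (-x) := by
  apply Complex.ext <;> simp only [Complex.conj_re, Complex.conj_im, rot_re, rot_im,
    Real.cos_neg, Real.sin_neg]

theorem rot_ne_zero (x : ℝ) : rot x ≠ 0 := Complex.exp_ne_zero _

theorem norm_mul_rot_arg (z : ℂ) : (‖z‖ : ℂ) * rot z.arg = z := Complex.norm_mul_exp_arg_mul_I z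

theorem rot_interpolate (x y z : ℝ) :
    (Real.sin (y - x) : ℂ) * rot z = Real.sin (y - z) * rot x + Real.sin (z - x) * rot y := by
  apply Complex.ext <;>
    simp only [Complex.add_re, Complex.add_im, Complex.re_ofReal_mul, Complex.im_ofReal_mul,
      rot_re, rot_im, Real.sin_sub] <;> ring

/-- A scaled linear identification of `ℂ²` with `ℝ⁴`. -/
def emb : ℂ × ℂ →ₗ[ℝ] ℝ⁴ where
  toFun p := pt ((1 / Real.sqrt 2) * p.1.re) ((1 / Real.sqrt 2) * p.1.im)
    ((1 / Real.sqrt 2) * p.2.re) ((1 / Real.sqrt 2) * p.2.im)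
  map_add' p p' := by
    ext n
    fin_cases n <;> simp [pt] <;> ring
  map_smul' c p := by
    ext n
    fin_cases n <;> simp [pt] <;> ring

theorem emb_injective : Function.Injective emb := by
  rw [injective_iff_map_eq_zero]
  intro p hp
  have h0 := congrArg (· 0) hp
  have h1 := congrArg (· 1) hp
  have h2 := congrArg (· 2) hp
  have h3 := congrArg (· 3) hp
  simp [emb, pt] at h0 h1 h2 h3
  exact Prod.ext (Complex.ext h0 h1) (Complex.ext h2 h3)

theorem emb_surjective : Function.Surjective emb := by
  intro x
  have h2 : Real.sqrt 2 ≠ 0 := by positivity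
  refine ⟨(⟨Real.sqrt 2 * x 0, Real.sqrt 2 * x 1⟩, ⟨Real.sqrt 2 * x 2, Real.sqrt 2 * x 3⟩), ?_⟩
  ext n
  fin_cases n <;> simp [emb, pt]

/-- The point of the torus at angles `2 * X * θ` and `2 * Y * θ`. -/
def torusPt (θ : ℝ) (X Y : ℤ) : ℝ⁴ := emb (rot (2 * X * θ), rot (2 * Y * θ))

theorem fpt_intCast {m : ℕ} [NeZero m] {θ : ℝ} (hθ : m * θ = π) (X Y : ℤ) :
    fpt m (X : ZMod m) (Y : ZMod m) = torusPt θ X Y := by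
  have hm0 : (m : ℝ) ≠ 0 := Nat.cast_ne_zero.2 (NeZero.ne m)
  have key : ∀ Z : ℤ, 2 * Z * θ = 2 * π * (Z : ZMod m).val / m + (Z / m : ℤ) * (2 * π) := by
    intro Z
    have h1 : (((Z : ZMod m).val : ℤ) : ℝ) = (Z % m : ℤ) := by rw [ZMod.val_intCast]
    have h2 : (Z : ℝ) = (Z % m : ℤ) + m * (Z / m : ℤ) := by
      exact_mod_cast (Int.emod_add_mul_ediv Z m).symm
    rw [Int.cast_natCast] at h1
    rw [h1, ← hθ]
    field_simp
    linear_combination θ * h2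
  unfold fpt torusPt emb
  simp only [LinearMap.coe_mk, AddHom.coe_mk, rot_re, rot_im, key X, key Y,
    Real.cos_add_int_mul_two_pi, Real.sin_add_int_mul_two_pi]

/-- The functional supporting the facet with parameter `k` based at `(i, j)`. -/
def facetFun (θ : ℝ) (q i j k : ℤ) : ℝ⁴ →L[ℝ] ℝ :=
  (2 : ℝ) • innerSL ℝ (emb ((Real.sin (k * θ) : ℂ) * rot ((2 * i + q - k + 1) * θ),
    (Real.sin ((q - k) * θ) : ℂ) * rot ((2 * j - k + 1) * θ)))

theorem facetFun_torusPt (θ : ℝ) (q i j k X Y : ℤ) :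
    facetFun θ q i j k (torusPt θ X Y) = facetVal θ q k (X - i) (Y - j) := by
  have hs : (Real.sqrt 2)⁻¹ * (Real.sqrt 2)⁻¹ = 1 / 2 := by
    rw [← mul_inv, Real.mul_self_sqrt (by norm_num)]; norm_num
  have e1 : (2 * ((X - i : ℤ) : ℝ) - q + k - 1) * θ = 2 * X * θ - (2 * i + q - k + 1) * θ := by
    push_cast; ring
  have e2 : (2 * ((Y - j : ℤ) : ℝ) + k - 1) * θ = 2 * Y * θ - (2 * j - k + 1) * θ := by
    push_cast; ring
  rw [facetVal, e1, e2, Real.cos_sub, Real.cos_sub]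
  simp only [facetFun, torusPt, emb, pt, smul_apply, innerSL_apply_apply, PiLp.inner_apply,
    Fin.sum_univ_four, LinearMap.coe_mk, AddHom.coe_mk, WithLp.equiv_symm_apply,
    Complex.re_ofReal_mul, Complex.im_ofReal_mul, rot_re, rot_im, Matrix.cons_val, smul_eq_mul,
    RCLike.inner_apply, conj_trivial, one_div]
  linear_combination (2 * (Real.cos (2 * X * θ) *
      (Real.sin (k * θ) * Real.cos ((2 * i + q - k + 1) * θ)) +
    Real.sin (2 * X * θ) * (Real.sin (k * θ) * Real.sin ((2 * i + q - k + 1) * θ)) +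
    Real.cos (2 * Y * θ) * (Real.sin ((q - k) * θ) * Real.cos ((2 * j - k + 1) * θ)) +
    Real.sin (2 * Y * θ) * (Real.sin ((q - k) * θ) * Real.sin ((2 * j - k + 1) * θ)))) * hs

theorem linearIndependent_torusPt {θ : ℝ} {q : ℤ} (h1 : Real.sin (2 * θ) ≠ 0)
    (hq : Real.sin (2 * q * θ) ≠ 0) (i j k : ℤ) :
    LinearIndependent ℝ ![torusPt θ i j, torusPt θ (i + 1) (j + 1),
      torusPt θ (i + q - k) (j - k), torusPt θ (i + q - k + 1) (j - k + 1)] := by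
  have hzero : ∀ a b : ℝ, (a : ℂ) + b * rot (2 * θ) = 0 → a = 0 ∧ b = 0 := by
    intro a b h
    have him := congrArg Complex.im h
    rw [Complex.add_im, Complex.im_ofReal_mul, rot_im, Complex.ofReal_im, zero_add,
      Complex.zero_im] at him
    have hb := (mul_eq_zero.1 him).resolve_right h1
    subst hb
    simpa using h
  rw [Fintype.linearIndependent_iff]
  intro g hg
  have hg' : emb (g 0 • (rot (2 * i * θ), rot (2 * j * θ)) +
      g 1 • (rot (2 * (i + 1 : ℤ) * θ), rot (2 * (j + 1 : ℤ) * θ)) +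
      g 2 • (rot (2 * (i + q - k : ℤ) * θ), rot (2 * (j - k : ℤ) * θ)) +
      g 3 • (rot (2 * (i + q - k + 1 : ℤ) * θ), rot (2 * (j - k + 1 : ℤ) * θ))) = 0 := by
    rw [map_add, map_add, map_add, map_smul, map_smul, map_smul, map_smul]
    simpa [Fin.sum_univ_four, torusPt] using hg
  have h0 := (injective_iff_map_eq_zero emb).1 emb_injective _ hg'
  have e1 : rot (2 * (i + 1 : ℤ) * θ) = rot (2 * i * θ) * rot (2 * θ) := by
    rw [← rot_add]; push_cast; ring_nf
  have e2 : rot (2 * (j + 1 : ℤ) * θ) = rot (2 * j * θ) * rot (2 * θ) := by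
    rw [← rot_add]; push_cast; ring_nf
  have e3 : rot (2 * (i + q - k + 1 : ℤ) * θ) = rot (2 * (i + q - k : ℤ) * θ) * rot (2 * θ) := by
    rw [← rot_add]; push_cast; ring_nf
  have e4 : rot (2 * (j - k + 1 : ℤ) * θ) = rot (2 * (j - k : ℤ) * θ) * rot (2 * θ) := by
    rw [← rot_add]; push_cast; ring_nf
  have e5 : rot (2 * j * θ) = rot (2 * i * θ) * rot (2 * (j - i) * θ) := by
    rw [← rot_add]; ring_nf
  have e6 : rot (2 * (i + q - k : ℤ) * θ) * rot (2 * (j - i) * θ) =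
      rot (2 * (j - k : ℤ) * θ) * rot (2 * q * θ) := by
    rw [← rot_add, ← rot_add]; push_cast; ring_nf
  have hf := congrArg Prod.fst h0
  have hs := congrArg Prod.snd h0
  simp only [Prod.fst_add, Prod.snd_add, Prod.smul_fst, Prod.smul_snd, Complex.real_smul,
    Prod.fst_zero, Prod.snd_zero] at hf hs
  rw [e1, e3] at hf
  rw [e2, e4] at hs
  have hω : rot (2 * q * θ) - 1 ≠ 0 := by
    intro h
    have := congrArg Complex.im h
    rw [Complex.sub_im, rot_im, Complex.one_im, Complex.zero_im, sub_zero] at this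
    exact hq this
  have h23 : (g 2 : ℂ) + g 3 * rot (2 * θ) = 0 := by
    have : rot (2 * (j - k : ℤ) * θ) * (rot (2 * q * θ) - 1) *
        (g 2 + g 3 * rot (2 * θ)) = 0 := by
      rw [e5] at hs
      linear_combination rot (2 * (j - i) * θ) * hf - hs -
        (g 2 + g 3 * rot (2 * θ)) * e6
    exact (mul_eq_zero.1 this).resolve_left (mul_ne_zero (rot_ne_zero _) hω)
  have h01 : (g 0 : ℂ) + g 1 * rot (2 * θ) = 0 := by
    have : rot (2 * i * θ) * (g 0 + g 1 * rot (2 * θ)) = 0 := by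
      linear_combination hf - rot (2 * (i + q - k : ℤ) * θ) * h23
    exact (mul_eq_zero.1 this).resolve_left (rot_ne_zero _)
  intro n
  have a := hzero _ _ h01
  have b := hzero _ _ h23
  fin_cases n
  exacts [a.1, a.2, b.1, b.2]

section Cover

variable {θ : ℝ}

theorem cone_smul_mem {C : Submodule ℝ≥0 ℝ⁴} {x : ℝ⁴} (hx : x ∈ C) {r : ℝ} (hr : 0 ≤ r) :
    r • x ∈ C := C.smul_mem (⟨r, hr⟩ : ℝ≥0) hx

theorem ray_mem_cone (hθ : 0 < θ) (hθ' : 2 * θ < π) {C : Submodule ℝ≥0 ℝ⁴} {α : ℝ} {e e' : ℤ}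
    (h0 : torusPt θ (⌊α / (2 * θ)⌋ + e) (⌊α / (2 * θ)⌋ + e') ∈ C)
    (h1 : torusPt θ (⌊α / (2 * θ)⌋ + e + 1) (⌊α / (2 * θ)⌋ + e' + 1) ∈ C)
    {r : ℝ} (hr : 0 ≤ r) :
    emb (r * rot (α + 2 * e * θ), r * rot (α + 2 * e' * θ)) ∈ C := by
  set s := ⌊α / (2 * θ)⌋
  have hs1 : s * (2 * θ) ≤ α := by
    rw [← le_div_iff₀ (by positivity)]; exact Int.floor_le _
  have hs2 : α < (s + 1) * (2 * θ) := by
    rw [← div_lt_iff₀ (by positivity)]; exact Int.lt_floor_add_one _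
  have hsin : 0 < Real.sin (2 * θ) := Real.sin_pos_of_pos_of_lt_pi (by positivity) hθ'
  have hl : 0 ≤ Real.sin ((s + 1) * (2 * θ) - α) :=
    Real.sin_nonneg_of_nonneg_of_le_pi (by linarith) (by linarith)
  have hr' : 0 ≤ Real.sin (α - s * (2 * θ)) :=
    Real.sin_nonneg_of_nonneg_of_le_pi (by linarith) (by linarith)
  have hsinC : (Real.sin (2 * θ) : ℂ) ≠ 0 := by exact_mod_cast hsin.ne'
  have key : ∀ f : ℤ, (Real.sin (2 * θ) : ℂ) * rot (α + 2 * f * θ) =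
      Real.sin ((s + 1) * (2 * θ) - α) * rot (2 * (s + f : ℤ) * θ) +
      Real.sin (α - s * (2 * θ)) * rot (2 * (s + f + 1 : ℤ) * θ) := by
    intro f
    have := rot_interpolate (2 * (s + f : ℤ) * θ) (2 * (s + f + 1 : ℤ) * θ) (α + 2 * f * θ)
    convert this using 4 <;> congr 1 <;> push_cast <;> ring
  have alg : ∀ S r A B x y z : ℂ, S ≠ 0 → S * z = A * x + B * y →
      r * z = r / S * A * x + r / S * B * y := by
    intro S r A B x y z hS h
    field_simp
    linear_combination r * h
  have : emb (r * rot (α + 2 * e * θ), r * rot (α + 2 * e' * θ)) =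
      (r / Real.sin (2 * θ) * Real.sin ((s + 1) * (2 * θ) - α)) • torusPt θ (s + e) (s + e') +
      (r / Real.sin (2 * θ) * Real.sin (α - s * (2 * θ))) •
        torusPt θ (s + e + 1) (s + e' + 1) := by
    rw [torusPt, torusPt, ← map_smul, ← map_smul, ← map_add]
    congr 1
    ext1
    · simp only [Prod.fst_add, Prod.smul_fst, Complex.real_smul, Complex.ofReal_mul,
        Complex.ofReal_div]
      exact alg _ _ _ _ _ _ _ hsinC (key e)
    · simp only [Prod.snd_add, Prod.smul_snd, Complex.real_smul, Complex.ofReal_mul,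
        Complex.ofReal_div]
      exact alg _ _ _ _ _ _ _ hsinC (key e')
  rw [this]
  exact C.add_mem (cone_smul_mem h0 (by positivity)) (cone_smul_mem h1 (by positivity))

theorem sum_rot_eq_zero {d : ℕ} (hd : 2 ≤ d) {δ : ℝ} (hδ : d * δ = π) (α : ℝ) :
    ∑ t ∈ Finset.range d, rot (α + 2 * (t : ℤ) * δ) = 0 := by
  have hd0 : (d : ℂ) ≠ 0 := by
    have : d ≠ 0 := by omega
    exact_mod_cast this
  have hδ' : (δ : ℂ) = π / d := by
    rw [eq_div_iff hd0, mul_comm]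
    exact_mod_cast hδ
  have hp := (Complex.isPrimitiveRoot_exp d (by omega)).geom_sum_eq_zero (by omega)
  have : ∀ t ∈ Finset.range d, rot (α + 2 * (t : ℤ) * δ) =
      rot α * Complex.exp (2 * π * Complex.I / d) ^ t := by
    intro t _
    rw [rot_add, ← Complex.exp_nat_mul]
    congr 1
    rw [rot]
    push_cast
    rw [hδ']
    ring_nf
  rw [Finset.sum_congr rfl this, ← Finset.mul_sum, hp, mul_zero]

theorem exists_polar_of_im {M N : ℂ} {γ₀ : ℝ} (h0 : 0 ≤ γ₀)
    (h1 : 0 < (N * (starRingEnd ℂ) M).im)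
    (h2 : (N * (starRingEnd ℂ) M * rot (-γ₀)).im < 0) :
    ∃ r r' α γ : ℝ, 0 ≤ r ∧ 0 ≤ r' ∧ 0 ≤ γ ∧ γ ≤ γ₀ ∧ M = r * rot α ∧ N = r' * rot (α + γ) := by
  set c := N * (starRingEnd ℂ) M with hc
  have hM : M ≠ 0 := by
    rintro rfl
    simp [hc] at h1
  have hMn : (‖M‖ : ℂ) ≠ 0 := by exact_mod_cast norm_ne_zero_iff.2 hM
  have hcn : 0 < ‖c‖ := by
    rw [norm_pos_iff]
    intro h
    simp [h] at h1
  refine ⟨‖M‖, ‖c‖ / ‖M‖, M.arg, c.arg, by positivity, by positivity,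
    Complex.arg_nonneg_iff.2 h1.le, ?_, (norm_mul_rot_arg M).symm, ?_⟩
  · by_contra! hlt
    rw [← norm_mul_rot_arg c, mul_assoc, ← rot_add, Complex.im_ofReal_mul, rot_im] at h2
    have h3 := Complex.arg_le_pi c
    have := Real.sin_nonneg_of_nonneg_of_le_pi (x := c.arg + -γ₀) (by linarith) (by linarith)
    nlinarith
  · have h3 : c * M = N * (‖M‖ : ℂ) ^ 2 := by
      rw [hc, mul_assoc, mul_comm _ M, Complex.mul_conj']
    have h4 := norm_mul_rot_arg c
    have h5 := norm_mul_rot_arg M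
    rw [rot_add]
    push_cast
    field_simp
    refine mul_right_cancel₀ hMn ?_
    linear_combination -h3 - c * h5 - (‖M‖ : ℂ) * rot M.arg * h4

theorem emb_inner_mem_cone {ω : ℕ → ℂ × ℂ} {d : ℕ} {C : Submodule ℝ≥0 ℝ⁴}
    (h : ∀ t, emb (ω t) ∈ C) {z : ℂ × ℂ} (hd : 0 < d)
    (hsum : ∑ t ∈ Finset.range d, ω t = (d : ℝ) • z) : emb z ∈ C := by
  have hd' : (d : ℝ) ≠ 0 := by positivity
  have : emb z = (1 / d : ℝ) • ∑ t ∈ Finset.range d, emb (ω t) := by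
    rw [← map_sum, hsum, map_smul, smul_smul, one_div_mul_cancel hd', one_smul]
  rw [this]
  exact cone_smul_mem (C.sum_mem fun t _ => h t) (by positivity)

/-- Cones over horizontal facets. -/
theorem horizontal_mem_cone {d : ℕ} (hd : 3 ≤ d) {q : ℤ} (hδ : d * (q * θ) = π)
    (hθ : 0 < θ) (hθ' : 2 * θ < π) {C : Submodule ℝ≥0 ℝ⁴} {ψ : ℝ}
    (hC : ∀ t : ℤ, torusPt θ (⌊ψ / (2 * θ)⌋ + q * t) ⌊ψ / (2 * θ)⌋ ∈ C ∧
      torusPt θ (⌊ψ / (2 * θ)⌋ + q * t + 1) (⌊ψ / (2 * θ)⌋ + 1) ∈ C)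
    {r p p' : ℝ} (hr : 0 ≤ r) (hp : 0 ≤ p) (hp' : 0 ≤ p') (hpp : p + p' ≤ 1) (t t' : ℤ) :
    emb (r * (p * rot (ψ + 2 * t * (q * θ)) + p' * rot (ψ + 2 * t' * (q * θ))), r * rot ψ) ∈ C := by
  have hray : ∀ t : ℤ, emb (r * rot (ψ + 2 * t * (q * θ)), r * rot ψ) ∈ C := by
    intro t
    have := ray_mem_cone hθ hθ' (C := C) (α := ψ) (e := q * t) (e' := 0)
      (by simpa using (hC t).1) (by simpa using (hC t).2) hr
    convert this using 6 <;> push_cast <;> ring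
  have h0 : emb ((0 : ℂ), (r : ℂ) * rot ψ) ∈ C := by
    refine emb_inner_mem_cone (d := d)
      (ω := fun t => (r * rot (ψ + 2 * (t : ℤ) * (q * θ)), r * rot ψ))
      (fun t => hray t) (by omega) ?_
    ext1
    · rw [Prod.fst_sum, ← Finset.mul_sum, sum_rot_eq_zero (by omega) hδ]
      simp
    · rw [Prod.snd_sum]
      simp
  have : emb (r * (p * rot (ψ + 2 * t * (q * θ)) + p' * rot (ψ + 2 * t' * (q * θ))), r * rot ψ) =
      p • emb (r * rot (ψ + 2 * t * (q * θ)), r * rot ψ) +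
      p' • emb (r * rot (ψ + 2 * t' * (q * θ)), r * rot ψ) +
      (1 - p - p') • emb ((0 : ℂ), (r : ℂ) * rot ψ) := by
    rw [← map_smul, ← map_smul, ← map_smul, ← map_add, ← map_add]
    congr 1
    ext1 <;> simp <;> ring
  rw [this]
  exact C.add_mem (C.add_mem (cone_smul_mem (hray t) hp) (cone_smul_mem (hray t') hp'))
    (cone_smul_mem h0 (by linarith))

/-- Cones over vertical facets. -/
theorem vertical_mem_cone {d : ℕ} (hd : 3 ≤ d) {q : ℤ} (hδ : d * (q * θ) = π)
    (hθ : 0 < θ) (hθ' : 2 * θ < π) {C : Submodule ℝ≥0 ℝ⁴} {ψ : ℝ}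
    (hC : ∀ t : ℤ, torusPt θ ⌊ψ / (2 * θ)⌋ (⌊ψ / (2 * θ)⌋ + q * t) ∈ C ∧
      torusPt θ (⌊ψ / (2 * θ)⌋ + 1) (⌊ψ / (2 * θ)⌋ + q * t + 1) ∈ C)
    {r p p' : ℝ} (hr : 0 ≤ r) (hp : 0 ≤ p) (hp' : 0 ≤ p') (hpp : p + p' ≤ 1) (t t' : ℤ) :
    emb (r * rot ψ, r * (p * rot (ψ + 2 * t * (q * θ)) + p' * rot (ψ + 2 * t' * (q * θ)))) ∈ C := by
  have hray : ∀ t : ℤ, emb (r * rot ψ, r * rot (ψ + 2 * t * (q * θ))) ∈ C := by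
    intro t
    have := ray_mem_cone hθ hθ' (C := C) (α := ψ) (e := 0) (e' := q * t)
      (by simpa using (hC t).1) (by simpa using (hC t).2) hr
    convert this using 6 <;> push_cast <;> ring
  have h0 : emb ((r : ℂ) * rot ψ, (0 : ℂ)) ∈ C := by
    refine emb_inner_mem_cone (d := d)
      (ω := fun t => (r * rot ψ, r * rot (ψ + 2 * (t : ℤ) * (q * θ))))
      (fun t => hray t) (by omega) ?_
    ext1
    · rw [Prod.fst_sum]
      simp
    · rw [Prod.snd_sum, ← Finset.mul_sum, sum_rot_eq_zero (by omega) hδ]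
      simp
  have : emb (r * rot ψ, r * (p * rot (ψ + 2 * t * (q * θ)) + p' * rot (ψ + 2 * t' * (q * θ)))) =
      p • emb (r * rot ψ, r * rot (ψ + 2 * t * (q * θ))) +
      p' • emb (r * rot ψ, r * rot (ψ + 2 * t' * (q * θ))) +
      (1 - p - p') • emb ((r : ℂ) * rot ψ, (0 : ℂ)) := by
    rw [← map_smul, ← map_smul, ← map_smul, ← map_add, ← map_add]
    congr 1
    ext1 <;> simp <;> ring
  rw [this]
  exact C.add_mem (C.add_mem (cone_smul_mem (hray t) hp) (cone_smul_mem (hray t') hp'))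
    (cone_smul_mem h0 (by linarith))

/-- Cones over facets with a general parameter, through the edges they contain on two adjacent
geodesics. -/
theorem diagonal_mem_cone {q : ℤ} (hθ : 0 < θ) (hθ' : 2 * θ < π) {α γ : ℝ} (hγ : 0 ≤ γ)
    (hγq : γ ≤ 2 * (q * θ)) (t : ℤ) :
    ∃ i j k : ℤ, 0 ≤ k ∧ k ≤ q ∧ q ∣ i - j ∧ ∀ C : Submodule ℝ≥0 ℝ⁴,
      torusPt θ i j ∈ C → torusPt θ (i + 1) (j + 1) ∈ C →
      torusPt θ (i + q - k) (j - k) ∈ C → torusPt θ (i + q - k + 1) (j - k + 1) ∈ C →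
      ∀ r r' : ℝ, 0 ≤ r → 0 ≤ r' →
        emb (r * rot α + r' * rot (α + γ),
          (r * rot α + r' * rot (α + γ) * rot (-(2 * (q * θ)))) * rot (-(2 * t * (q * θ)))) ∈ C := by
  set s := ⌊α / (2 * θ)⌋ with hs
  set s' := ⌊(α + γ) / (2 * θ)⌋ with hs'
  have h1 : s ≤ s' := Int.floor_mono (by gcongr; linarith)
  have h2 : s' ≤ s + q := by
    rw [hs, hs', ← Int.floor_add_intCast]
    apply Int.floor_mono
    rw [div_add' _ _ _ (by positivity)]
    gcongr
    linarith
  refine ⟨s, s - q * t, s + q - s', by omega, by omega, ⟨t, by ring⟩, ?_⟩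
  intro C c0 c1 c2 c3 r r' hr hr'
  have e1 := ray_mem_cone hθ hθ' (C := C) (α := α) (e := 0) (e' := -(q * t))
    (by convert c0 using 2 <;> simp only [← hs] <;> ring)
    (by convert c1 using 2 <;> simp only [← hs] <;> ring) hr
  have e2 := ray_mem_cone hθ hθ' (C := C) (α := α + γ) (e := 0) (e' := -(q * t) - q)
    (by convert c2 using 2 <;> rw [← hs'] <;> ring)
    (by convert c3 using 2 <;> rw [← hs'] <;> ring) hr'
  convert C.add_mem e1 e2 using 1
  rw [← map_add]
  congr 1
  ext1
  · simp
  · simp only [Prod.snd_add, add_mul, mul_assoc, ← rot_add]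
    congr 3 <;> push_cast <;> ring_nf

theorem sin_sub_add_sin (η δ : ℝ) :
    Real.sin (2 * δ - η) + Real.sin η = 2 * Real.sin δ * Real.cos (η - δ) := by
  have e1 : 2 * δ - η = δ - (η - δ) := by ring
  have e2 : η = δ + (η - δ) := by ring
  rw [e1, Real.sin_sub]
  nth_rewrite 3 [e2]
  rw [Real.sin_add]
  ring

theorem chord_coeffs {η δ R R' : ℝ} (hδ : 0 < δ) (hδ' : δ < π / 2) (hη : 0 ≤ η) (hη' : η ≤ 2 * δ)
    (hR : 0 ≤ R) (hR' : 0 < R') (h : R * Real.cos (η - δ) ≤ R' * Real.cos δ) :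
    ∃ p p' : ℝ, 0 ≤ p ∧ 0 ≤ p' ∧ p + p' ≤ 1 ∧ R' * p * Real.sin (2 * δ) = R * Real.sin (2 * δ - η) ∧
      R' * p' * Real.sin (2 * δ) = R * Real.sin η := by
  have hs : 0 < Real.sin (2 * δ) := Real.sin_pos_of_pos_of_lt_pi (by linarith) (by linarith)
  have hs1 : 0 < Real.sin δ := Real.sin_pos_of_pos_of_lt_pi (by linarith) (by linarith)
  have h1 : 0 ≤ Real.sin (2 * δ - η) :=
    Real.sin_nonneg_of_nonneg_of_le_pi (by linarith) (by linarith)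
  have h2 : 0 ≤ Real.sin η := Real.sin_nonneg_of_nonneg_of_le_pi (by linarith) (by linarith)
  refine ⟨R * Real.sin (2 * δ - η) / (R' * Real.sin (2 * δ)),
    R * Real.sin η / (R' * Real.sin (2 * δ)), by positivity, by positivity, ?_, ?_, ?_⟩
  · rw [← add_div, ← mul_add, sin_sub_add_sin, div_le_one (by positivity), Real.sin_two_mul]
    nlinarith
  · rw [mul_assoc, div_mul_eq_mul_div, mul_div_assoc', div_eq_iff (by positivity)]
    ring
  · rw [mul_assoc, div_mul_eq_mul_div, mul_div_assoc', div_eq_iff (by positivity)]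
    ring

/-- A point of `ℂ²` between the horizontal and the vertical cones, split along two adjacent
geodesics. -/
theorem exists_split {η δ R R' : ℝ} (ψ : ℝ) (hδ : 0 < δ) (hδ' : δ < π / 2)
    (hR : 0 < R) (hR' : 0 < R') (h : R' * Real.cos δ < R * Real.cos (η - δ))
    (h' : R * Real.cos δ < R' * Real.cos (η - δ)) :
    ∃ r r' α γ : ℝ, 0 ≤ r ∧ 0 ≤ r' ∧ 0 ≤ γ ∧ γ ≤ 2 * δ ∧
      R * rot (ψ + η) = r * rot α + r' * rot (α + γ) ∧
      R' * rot ψ = r * rot α + r' * rot (α + γ) * rot (-(2 * δ)) := by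
  have hs1 : 0 < Real.sin δ := Real.sin_pos_of_pos_of_lt_pi (by linarith) (by linarith)
  have hsum := sin_sub_add_sin η δ
  have hNM : (R * rot η - R') * (starRingEnd ℂ) (R' - R * rot (η - 2 * δ)) =
      (R * R' : ℝ) * rot η - (R ^ 2 : ℝ) * rot (2 * δ) - (R' ^ 2 : ℝ) * rot 0 +
        (R * R' : ℝ) * rot (2 * δ - η) := by
    have e : rot (2 * δ) = rot η * rot (2 * δ - η) := by rw [← rot_add]; ring_nf
    rw [map_sub, map_mul, Complex.conj_ofReal, Complex.conj_ofReal, conj_rot, neg_sub, e, rot_zero]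
    push_cast
    ring
  obtain ⟨r, r', α, γ, hr, hr', hγ, hγ', hM, hN⟩ := exists_polar_of_im
    (M := R' - R * rot (η - 2 * δ)) (N := R * rot η - R') (γ₀ := 2 * δ) (by linarith)
    (by
      have : ((R * rot η - R') * (starRingEnd ℂ) (R' - R * rot (η - 2 * δ))).im =
          2 * Real.sin δ * R * (R' * Real.cos (η - δ) - R * Real.cos δ) := by
        simp only [hNM, Complex.sub_im, Complex.add_im, Complex.im_ofReal_mul, rot_im,
          Real.sin_zero]
        linear_combination R * R' * hsum - R ^ 2 * Real.sin_two_mul δ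
      rw [this]
      exact mul_pos (by positivity) (by linarith))
    (by
      have : ((R * rot η - R') * (starRingEnd ℂ) (R' - R * rot (η - 2 * δ)) *
          rot (-(2 * δ))).im =
          2 * Real.sin δ * R' * (R' * Real.cos δ - R * Real.cos (η - δ)) := by
        simp only [hNM, sub_mul, add_mul, mul_assoc, ← rot_add, Complex.sub_im, Complex.add_im,
          Complex.im_ofReal_mul, rot_im]
        have a1 : η + -(2 * δ) = -(2 * δ - η) := by ring
        have a2 : 2 * δ - η + -(2 * δ) = -η := by ring
        rw [a1, a2, add_neg_cancel, zero_add, Real.sin_neg, Real.sin_neg, Real.sin_neg,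
          Real.sin_zero]
        linear_combination -R * R' * hsum + R' ^ 2 * Real.sin_two_mul δ
      rw [this]
      exact mul_neg_of_pos_of_neg (by positivity) (by linarith))
  have hsC : (2 * Real.sin δ : ℂ) ≠ 0 := by
    have : 2 * Real.sin δ ≠ 0 := by positivity
    exact_mod_cast this
  have hI : rot (δ - π / 2) * (rot (-(2 * δ)) - 1) = - (2 * Real.sin δ : ℂ) := by
    have e : δ - π / 2 + -(2 * δ) = -δ - π / 2 := by ring
    have hc : - (2 * Real.sin δ : ℂ) = ((-(2 * Real.sin δ) : ℝ) : ℂ) := by push_cast; rfl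
    rw [mul_sub, ← rot_add, mul_one, e, hc]
    apply Complex.ext
    · rw [Complex.sub_re, rot_re, rot_re, Real.cos_sub_pi_div_two, Real.cos_sub_pi_div_two,
        Real.sin_neg, Complex.ofReal_re]
      ring
    · rw [Complex.sub_im, rot_im, rot_im, Real.sin_sub_pi_div_two, Real.sin_sub_pi_div_two,
        Real.cos_neg, Complex.ofReal_im, sub_self]
  have e1 : rot (α + (ψ + (δ - π / 2))) = rot α * (rot ψ * rot (δ - π / 2)) := by
    rw [rot_add, rot_add]
  have e2 : rot (α + (ψ + (δ - π / 2)) + γ) = rot (α + γ) * (rot ψ * rot (δ - π / 2)) := by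
    rw [← rot_add, ← rot_add]; ring_nf
  have e3 : rot (η - 2 * δ) = rot η * rot (-(2 * δ)) := by rw [← rot_add]; ring_nf
  rw [e3] at hM
  refine ⟨r / (2 * Real.sin δ), r' / (2 * Real.sin δ), α + (ψ + (δ - π / 2)), γ, by positivity,
    by positivity, hγ, hγ', ?_, ?_⟩
  · rw [e1, e2, rot_add]
    simp only [Complex.ofReal_div, Complex.ofReal_mul, Complex.ofReal_ofNat]
    rw [div_mul_eq_mul_div, div_mul_eq_mul_div, ← add_div, eq_div_iff hsC]
    linear_combination (rot ψ * rot (δ - π / 2)) * (hM + hN) + R * rot η * rot ψ * hI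
  · rw [e1, e2]
    simp only [Complex.ofReal_div, Complex.ofReal_mul, Complex.ofReal_ofNat]
    rw [div_mul_eq_mul_div, div_mul_eq_mul_div, div_mul_eq_mul_div, ← add_div, eq_div_iff hsC]
    linear_combination (rot ψ * rot (δ - π / 2)) * (hM + rot (-(2 * δ)) * hN) + R' * rot ψ * hI

theorem exists_mem_cone {d : ℕ} (hd : 3 ≤ d) {q : ℤ} (hδ : d * (q * θ) = π)
    (hq : 1 ≤ q) (hθ : 0 < θ) (C : ℤ → ℤ → ℤ → Submodule ℝ≥0 ℝ⁴)
    (hcorner : ∀ i j k, 0 ≤ k → k ≤ q → q ∣ i - j → torusPt θ i j ∈ C i j k ∧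
      torusPt θ (i + 1) (j + 1) ∈ C i j k ∧ torusPt θ (i + q - k) (j - k) ∈ C i j k ∧
      torusPt θ (i + q - k + 1) (j - k + 1) ∈ C i j k)
    (hhor : ∀ s t : ℤ, torusPt θ (s + q * t) s ∈ C s s 0 ∧
      torusPt θ (s + q * t + 1) (s + 1) ∈ C s s 0)
    (hver : ∀ s t : ℤ, torusPt θ s (s + q * t) ∈ C s s q ∧
      torusPt θ (s + 1) (s + q * t + 1) ∈ C s s q) (x : ℝ⁴) :
    ∃ i j k, 0 ≤ k ∧ k ≤ q ∧ q ∣ i - j ∧ x ∈ C i j k := by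
  have hd3 : (3 : ℝ) ≤ d := by exact_mod_cast hd
  have hq1 : (1 : ℝ) ≤ q := by exact_mod_cast hq
  set δ := q * θ with hδ_def
  have hδ0 : 0 < δ := by positivity
  have hδ3 : 3 * δ ≤ π := by nlinarith
  have hθδ : θ ≤ δ := by nlinarith
  have hθ' : 2 * θ < π := by linarith
  have hδ2 : δ < π / 2 := by linarith
  obtain ⟨⟨z₁, z₂⟩, rfl⟩ := emb_surjective x
  obtain ⟨R, ψ₁, hR, rfl⟩ : ∃ R ψ : ℝ, 0 ≤ R ∧ z₁ = R * rot ψ :=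
    ⟨‖z₁‖, z₁.arg, norm_nonneg _, (norm_mul_rot_arg z₁).symm⟩
  obtain ⟨R', ψ₂, hR', rfl⟩ : ∃ R ψ : ℝ, 0 ≤ R ∧ z₂ = R * rot ψ :=
    ⟨‖z₂‖, z₂.arg, norm_nonneg _, (norm_mul_rot_arg z₂).symm⟩
  rcases hR'.eq_or_lt with rfl | hR'
  · refine ⟨⌊ψ₁ / (2 * θ)⌋, ⌊ψ₁ / (2 * θ)⌋, q, by omega, le_rfl, by simp, ?_⟩
    have := vertical_mem_cone hd hδ hθ hθ' (hver _) hR le_rfl le_rfl (by norm_num) 0 0 (ψ := ψ₁)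
    simpa using this
  set t := ⌊(ψ₁ - ψ₂) / (2 * δ)⌋ with ht
  obtain ⟨η, hη⟩ : ∃ η, η = ψ₁ - ψ₂ - t * (2 * δ) := ⟨_, rfl⟩
  have hη0 : 0 ≤ η := by
    have : t * (2 * δ) ≤ ψ₁ - ψ₂ := by
      rw [← le_div_iff₀ (by positivity)]; exact Int.floor_le _
    linarith
  have hη1 : η ≤ 2 * δ := by
    have : ψ₁ - ψ₂ < (t + 1) * (2 * δ) := by
      rw [← div_lt_iff₀ (by positivity)]; exact Int.lt_floor_add_one _
    linarith
  have hsinC : (Real.sin (2 * δ) : ℂ) ≠ 0 := by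
    have := (Real.sin_pos_of_pos_of_lt_pi (x := 2 * δ) (by linarith) (by linarith)).ne'
    exact_mod_cast this
  have hcos : 0 < Real.cos (η - δ) := Real.cos_pos_of_mem_Ioo ⟨by linarith, by linarith⟩
  have hcosδ : 0 < Real.cos δ := Real.cos_pos_of_mem_Ioo ⟨by linarith, by linarith⟩
  rcases le_or_gt (R * Real.cos (η - δ)) (R' * Real.cos δ) with hH | hH
  · obtain ⟨p, p', hp, hp', hpp, h1, h2⟩ := chord_coeffs hδ0 hδ2 hη0 hη1 hR hR' hH
    refine ⟨⌊ψ₂ / (2 * θ)⌋, ⌊ψ₂ / (2 * θ)⌋, 0, le_rfl, by omega, by simp, ?_⟩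
    have := horizontal_mem_cone hd hδ hθ hθ' (hhor _) hR'.le hp hp' hpp t (t + 1) (ψ := ψ₂)
    convert this using 3
    have key := rot_interpolate (ψ₂ + 2 * t * δ) (ψ₂ + 2 * (t + 1 : ℤ) * δ) ψ₁
    have a1 : ψ₂ + 2 * (t + 1 : ℤ) * δ - (ψ₂ + 2 * t * δ) = 2 * δ := by push_cast; ring
    have a2 : ψ₂ + 2 * (t + 1 : ℤ) * δ - ψ₁ = 2 * δ - η := by rw [hη]; push_cast; ring
    have a3 : ψ₁ - (ψ₂ + 2 * t * δ) = η := by rw [hη]; ring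
    rw [a1, a2, a3] at key
    have h1' := congrArg Complex.ofReal h1
    have h2' := congrArg Complex.ofReal h2
    simp only [Complex.ofReal_mul] at h1' h2'
    refine mul_left_cancel₀ hsinC ?_
    linear_combination R * key - rot (ψ₂ + 2 * t * δ) * h1' -
      rot (ψ₂ + 2 * (t + 1 : ℤ) * δ) * h2'
  have hR0 : 0 < R := pos_of_mul_pos_left ((by positivity : 0 < R' * Real.cos δ).trans hH) hcos.le
  rcases le_or_gt (R' * Real.cos (η - δ)) (R * Real.cos δ) with hV | hV
  · obtain ⟨p, p', hp, hp', hpp, h1, h2⟩ := chord_coeffs hδ0 hδ2 hη0 hη1 hR'.le hR0 hV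
    refine ⟨⌊ψ₁ / (2 * θ)⌋, ⌊ψ₁ / (2 * θ)⌋, q, by omega, le_rfl, by simp, ?_⟩
    have := vertical_mem_cone hd hδ hθ hθ' (hver _) hR0.le hp hp' hpp (-t) (-t - 1) (ψ := ψ₁)
    convert this using 3
    have key := rot_interpolate (ψ₁ + 2 * (-t - 1 : ℤ) * δ) (ψ₁ + 2 * (-t : ℤ) * δ) ψ₂
    have a1 : ψ₁ + 2 * (-t : ℤ) * δ - (ψ₁ + 2 * (-t - 1 : ℤ) * δ) = 2 * δ := by push_cast; ring
    have a2 : ψ₁ + 2 * (-t : ℤ) * δ - ψ₂ = η := by rw [hη]; push_cast; ring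
    have a3 : ψ₂ - (ψ₁ + 2 * (-t - 1 : ℤ) * δ) = 2 * δ - η := by rw [hη]; push_cast; ring
    rw [a1, a2, a3] at key
    have h1' := congrArg Complex.ofReal h1
    have h2' := congrArg Complex.ofReal h2
    simp only [Complex.ofReal_mul] at h1' h2'
    refine mul_left_cancel₀ hsinC ?_
    linear_combination R' * key - rot (ψ₁ + 2 * (-t : ℤ) * δ) * h1' -
      rot (ψ₁ + 2 * (-t - 1 : ℤ) * δ) * h2'
  · obtain ⟨r, r', α, γ, hr, hr', hγ, hγ', h1, h2⟩ :=
      exists_split (ψ₂ + 2 * t * δ) hδ0 hδ2 hR0 hR' hH hV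
    obtain ⟨i, j, k, hk, hkq, hij, hC⟩ := diagonal_mem_cone hθ hθ' hγ hγ' t
    obtain ⟨c0, c1, c2, c3⟩ := hcorner i j k hk hkq hij
    refine ⟨i, j, k, hk, hkq, hij, ?_⟩
    convert hC (C i j k) c0 c1 c2 c3 r r' hr hr' using 3
    · rw [← h1, hη]
      congr 2
      ring
    · rw [← hδ_def, ← h2, mul_assoc, ← rot_add]
      congr 2
      ring

end Cover

theorem natCast_ne_zero_of_lt {m n : ℕ} (h0 : 0 < n) (hn : n < m) : (n : ZMod m) ≠ 0 := by
  rw [Ne, ZMod.natCast_eq_zero_iff]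
  exact Nat.not_dvd_of_pos_of_lt h0 hn

theorem dvd_val_natCast_self {m q : ℕ} (hqm : q ∣ m) : q ∣ (q : ZMod m).val := by
  rw [ZMod.val_natCast]
  exact (Nat.dvd_mod_iff hqm).2 dvd_rfl

section Index

variable {m q : ℕ} [NeZero m]

theorem dvd_val_intCast (hqm : q ∣ m) (z : ℤ) : q ∣ (z : ZMod m).val ↔ (q : ℤ) ∣ z := by
  rw [← Int.natCast_dvd_natCast, ZMod.val_intCast, Int.emod_def,
    dvd_sub_left (Dvd.dvd.mul_right (Int.natCast_dvd_natCast.2 hqm) _)]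

theorem intCast_val (a : ZMod m) : ((a.val : ℤ) : ZMod m) = a := by simp

theorem dvd_val_sub (hqm : q ∣ m) (a b : ZMod m) :
    q ∣ (a - b).val ↔ (q : ℤ) ∣ (a.val : ℤ) - b.val := by
  rw [← dvd_val_intCast hqm]
  simp

theorem dvd_val_add (hqm : q ∣ m) {a b : ZMod m} (ha : q ∣ a.val) (hb : q ∣ b.val) :
    q ∣ (a + b).val := by
  rw [ZMod.val_add]
  exact (Nat.dvd_mod_iff hqm).2 (dvd_add ha hb)

theorem dvd_val_sub_natCast_self (hqm : q ∣ m) {a b : ZMod m} (h : a - b = q ∨ b - a = q ∨ a = b) :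
    q ∣ (a - b).val := by
  rcases h with h | h | h
  · rw [h]; exact dvd_val_natCast_self hqm
  · rw [← neg_sub, h]
    have := (dvd_val_intCast (m := m) hqm (-q)).2 (by simp)
    simpa using this
  · simp [h]

theorem card_dvd_val {d : ℕ} (hq : 1 ≤ q) (hm : m = d * q) :
    (Finset.univ.filter fun z : ZMod m => q ∣ z.val).card = d := by
  have hlt : ∀ t ∈ Finset.range d, q * t < m := fun t ht => by
    rw [hm, mul_comm]
    exact Nat.mul_lt_mul_of_pos_right (Finset.mem_range.1 ht) hq
  rw [← Finset.card_range d]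
  refine Finset.card_nbij' (fun z => z.val / q) (fun t => ((q * t : ℕ) : ZMod m)) ?_ ?_ ?_ ?_
  · intro z _
    have := ZMod.val_lt z
    simp only [Finset.coe_range, Set.mem_Iio]
    exact Nat.div_lt_of_lt_mul (by rw [mul_comm]; omega)
  · intro t ht
    simp [ZMod.val_cast_of_lt (hlt t ht), -Nat.cast_mul]
  · intro z hz
    simp only [Finset.coe_filter, Finset.mem_univ, true_and, Set.mem_ofPred_eq] at hz
    simp only [Nat.mul_div_cancel' hz, ZMod.natCast_zmod_val]
  · intro t ht
    simp only [ZMod.val_cast_of_lt (hlt t ht)]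
    exact Nat.mul_div_cancel_left t hq

theorem card_index {d : ℕ} (hq : 1 ≤ q) (hm : m = d * q) :
    (Finset.univ.filter fun p : ZMod m × ZMod m => q ∣ (p.1 - p.2).val).card = m * d := by
  have h : ((Finset.univ : Finset (ZMod m)) ×ˢ
      Finset.univ.filter fun z : ZMod m => q ∣ z.val).card = m * d := by
    rw [Finset.card_product, card_dvd_val hq hm, Finset.card_univ, ZMod.card]
  rw [← h]
  refine Finset.card_nbij' (fun p => (p.2, p.1 - p.2)) (fun p => (p.2 + p.1, p.1)) ?_ ?_ ?_ ?_
  · intro p hp; simpa using hp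
  · intro p hp; simpa using hp
  · intro p _; simp
  · intro p _; simp

/-- The labels of the vertical, horizontal and diagonal facets. -/
abbrev FacetIndex (m q : ℕ) : Type :=
  ZMod m ⊕ ZMod m ⊕ {p : ZMod m × ZMod m // q ∣ (p.1 - p.2).val} × Fin (q - 1)

/-- The base point and the parameter of a facet. -/
def facetBase (q : ℕ) : FacetIndex m q → (ZMod m × ZMod m) × ℤ
  | .inl i => ((i, i), q)
  | .inr (.inl j) => ((j, j), 0)
  | .inr (.inr (p, k)) => (p.1, (k : ℤ) + 1)

/-- The indices of the vertices of a facet. -/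
def facetVerts (q : ℕ) : FacetIndex m q → Set (ZMod m × ZMod m)
  | .inl i => {p | q ∣ (p.1 - p.2).val ∧ (p.1 = i ∨ p.1 = i + 1)}
  | .inr (.inl j) => {p | q ∣ (p.1 - p.2).val ∧ (p.2 = j ∨ p.2 = j + 1)}
  | .inr (.inr (p, k)) => {p.1, (p.1.1 + 1, p.1.2 + 1),
      (p.1.1 + q - (k + 1 : ℕ), p.1.2 - (k + 1 : ℕ)),
      (p.1.1 + q - (k + 1 : ℕ) + 1, p.1.2 - (k + 1 : ℕ) + 1)}

theorem facetVerts_injective {d : ℕ} (hd : 3 ≤ d) (hq : 1 ≤ q) (hm : m = d * q) :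
    Function.Injective (facetVerts (m := m) q) := by
  have hm3 : 3 * q ≤ m := by rw [hm]; exact Nat.mul_le_mul_right q hd
  have hqm : q ∣ m := ⟨d, by rw [hm, mul_comm]⟩
  have hQ := natCast_ne_zero_of_lt (m := m) (n := q) hq (by omega)
  have hQ2 := natCast_ne_zero_of_lt (m := m) (n := 2 * q) (by omega) (by omega)
  have h2 := natCast_ne_zero_of_lt (m := m) (n := 2) (by omega) (by omega)
  push_cast at hQ2 h2
  have hvv : ∀ i i' : ZMod m, facetVerts q (.inl i) = facetVerts q (.inl i') →
      i = i' := by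
    intro i i' h
    have a1 := (Set.ext_iff.1 h (i, i)).1 (by simp [facetVerts])
    have a2 := (Set.ext_iff.1 h (i', i')).2 (by simp [facetVerts])
    simp only [facetVerts, Set.mem_ofPred_eq] at a1 a2
    grind
  have hhh : ∀ i i' : ZMod m, facetVerts q (.inr (.inl i)) =
      facetVerts q (.inr (.inl i')) → i = i' := by
    intro i i' h
    have a1 := (Set.ext_iff.1 h (i, i)).1 (by simp [facetVerts])
    have a2 := (Set.ext_iff.1 h (i', i')).2 (by simp [facetVerts])
    simp only [facetVerts, Set.mem_ofPred_eq] at a1 a2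
    grind
  have hv0 : ∀ i : ZMod m, (i, i) ∈ facetVerts q (.inl i) ∧
      (i, i + q) ∈ facetVerts q (.inl i) ∧
      (i, i - q) ∈ facetVerts q (.inl i) := fun i =>
    ⟨⟨dvd_val_sub_natCast_self hqm (by simp), by simp⟩,
      ⟨dvd_val_sub_natCast_self hqm (by simp), by simp⟩,
      ⟨dvd_val_sub_natCast_self hqm (by simp), by simp⟩⟩
  have hh0 : ∀ j : ZMod m, (j, j) ∈ facetVerts q (.inr (.inl j)) ∧
      (j + q, j) ∈ facetVerts q (.inr (.inl j)) ∧
      (j - q, j) ∈ facetVerts q (.inr (.inl j)) := fun i =>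
    ⟨⟨dvd_val_sub_natCast_self hqm (by simp), by simp⟩,
      ⟨dvd_val_sub_natCast_self hqm (by simp), by simp⟩,
      ⟨dvd_val_sub_natCast_self hqm (by simp), by simp⟩⟩
  have hvh : ∀ i j : ZMod m, facetVerts q (.inl i) ≠
      facetVerts q (.inr (.inl j)) := by
    intro i j h
    obtain ⟨a1, a2, a3⟩ := hv0 i
    rw [h] at a1 a2 a3
    simp only [facetVerts, Set.mem_ofPred_eq] at a1 a2 a3
    grind
  have hvd : ∀ (i : ZMod m) t, facetVerts q (.inl i) ≠
      facetVerts q (.inr (.inr t)) := by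
    rintro i ⟨⟨⟨a, b⟩, hp⟩, k⟩ h
    obtain ⟨a1, a2, a3⟩ := hv0 i
    rw [h] at a1 a2 a3
    simp only [facetVerts, Set.mem_insert_iff, Set.mem_singleton_iff, Prod.mk.injEq]
      at a1 a2 a3
    have e : ∀ x y : ZMod m, (x = a ∧ y = b ∨ x = a + 1 ∧ y = b + 1 ∨
        x = a + q - (k + 1 : ℕ) ∧ y = b - (k + 1 : ℕ) ∨
        x = a + q - (k + 1 : ℕ) + 1 ∧ y = b - (k + 1 : ℕ) + 1) →
        x - y = a - b ∨ x - y = a - b + q := by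
      rintro x y (⟨rfl, rfl⟩ | ⟨rfl, rfl⟩ | ⟨rfl, rfl⟩ | ⟨rfl, rfl⟩) <;> grind
    replace a1 := e _ _ a1
    replace a2 := e _ _ a2
    replace a3 := e _ _ a3
    grind
  have hhd : ∀ (i : ZMod m) t, facetVerts q (.inr (.inl i)) ≠
      facetVerts q (.inr (.inr t)) := by
    rintro i ⟨⟨⟨a, b⟩, hp⟩, k⟩ h
    obtain ⟨a1, a2, a3⟩ := hh0 i
    rw [h] at a1 a2 a3
    simp only [facetVerts, Set.mem_insert_iff, Set.mem_singleton_iff, Prod.mk.injEq]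
      at a1 a2 a3
    have e : ∀ x y : ZMod m, (x = a ∧ y = b ∨ x = a + 1 ∧ y = b + 1 ∨
        x = a + q - (k + 1 : ℕ) ∧ y = b - (k + 1 : ℕ) ∨
        x = a + q - (k + 1 : ℕ) + 1 ∧ y = b - (k + 1 : ℕ) + 1) →
        x - y = a - b ∨ x - y = a - b + q := by
      rintro x y (⟨rfl, rfl⟩ | ⟨rfl, rfl⟩ | ⟨rfl, rfl⟩ | ⟨rfl, rfl⟩) <;> grind
    replace a1 := e _ _ a1
    replace a2 := e _ _ a2
    replace a3 := e _ _ a3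
    grind
  have hdd : ∀ t t', facetVerts (m := m) q (.inr (.inr t)) =
      facetVerts q (.inr (.inr t')) → t = t' := by
    rintro ⟨⟨⟨a, b⟩, hp⟩, k⟩ ⟨⟨⟨a', b'⟩, hp'⟩, k'⟩ h
    have a1 := (Set.ext_iff.1 h (a, b)).1 (by simp [facetVerts])
    have a2 := (Set.ext_iff.1 h (a', b')).2 (by simp [facetVerts])
    have a3 := (Set.ext_iff.1 h (a + q - (k + 1 : ℕ), b - (k + 1 : ℕ))).1
      (by simp [facetVerts])
    have a4 := (Set.ext_iff.1 h (a' + q - (k' + 1 : ℕ), b' - (k' + 1 : ℕ))).2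
      (by simp [facetVerts])
    have hinj : ((k + 1 : ℕ) : ZMod m) = (k' + 1 : ℕ) → k = k' := by
      intro hk
      have := congrArg ZMod.val hk
      rw [ZMod.val_cast_of_lt (by omega), ZMod.val_cast_of_lt (by omega)] at this
      exact Fin.ext (by omega)
    simp only [facetVerts, Set.mem_insert_iff, Set.mem_singleton_iff, Prod.mk.injEq]
      at a1 a2 a3 a4
    generalize ((k + 1 : ℕ) : ZMod m) = K at *
    generalize ((k' + 1 : ℕ) : ZMod m) = K' at *
    generalize (q : ZMod m) = Q at *
    have hab : a - b = a' - b' := by grind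
    have ha : a = a' := by grind
    have hb : b = b' := by grind
    subst ha hb
    have hK : K = K' := by grind
    rw [hinj hK]
  rintro (i | i | t) (i' | i' | t') h
  · rw [hvv _ _ h]
  · exact absurd h (hvh _ _)
  · exact absurd h (hvd _ _)
  · exact absurd h.symm (hvh _ _)
  · rw [hhh _ _ h]
  · exact absurd h (hhd _ _)
  · exact absurd h.symm (hvd _ _)
  · exact absurd h.symm (hhd _ _)
  · rw [hdd _ _ h]

theorem dvd_of_mem_facetVerts (hqm : q ∣ m) {t : FacetIndex m q} {p : ZMod m × ZMod m}
    (hp : p ∈ facetVerts q t) : q ∣ (p.1 - p.2).val := by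
  rcases t with i | j | ⟨⟨w, hw⟩, k⟩
  · exact hp.1
  · exact hp.1
  · have h : q ∣ (w.1 - w.2 + q).val := dvd_val_add hqm hw (dvd_val_natCast_self hqm)
    rcases hp with rfl | rfl | rfl | rfl
    · exact hw
    · simpa using hw
    · convert h using 2; ring
    · convert h using 2; ring

end Index

theorem dvd_of_facetBase {m q : ℕ} (t : FacetIndex m q) :
    q ∣ ((facetBase q t).1.1 - (facetBase q t).1.2).val := by
  rcases t with i | j | ⟨⟨w, hw⟩, k⟩
  · simp [facetBase]
  · simp [facetBase]
  · exact hw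

theorem facetBase_mem_Icc {m q : ℕ} (t : FacetIndex m q) :
    0 ≤ (facetBase q t).2 ∧ (facetBase q t).2 ≤ q := by
  rcases t with i | j | ⟨w, k⟩ <;> simp only [facetBase] <;> omega

theorem facetFun_zero (θ : ℝ) (q i i' j : ℤ) : facetFun θ q i j 0 = facetFun θ q i' j 0 := by
  simp [facetFun]

theorem facetFun_self (θ : ℝ) (q i j j' : ℤ) : facetFun θ q i j q = facetFun θ q i j' q := by
  simp [facetFun]

theorem facetFun_congr {m : ℕ} {θ : ℝ} (hθ : m * θ = π) (q : ℤ) {i i' j j' : ℤ} (k : ℤ)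
    (hi : (i : ZMod m) = i') (hj : (j : ZMod m) = j') :
    facetFun θ q i j k = facetFun θ q i' j' k := by
  obtain ⟨u, hu⟩ := (ZMod.intCast_eq_intCast_iff_dvd_sub _ _ _).1 hi
  obtain ⟨v, hv⟩ := (ZMod.intCast_eq_intCast_iff_dvd_sub _ _ _).1 hj
  have hrot : ∀ (y : ℝ) (n : ℤ), rot (y + 2 * (m * n) * θ) = rot y := by
    intro y n
    have e : y + 2 * (m * n) * θ = y + n * (2 * π) := by rw [← hθ]; ring
    apply Complex.ext
    · rw [rot_re, rot_re, e, Real.cos_add_int_mul_two_pi]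
    · rw [rot_im, rot_im, e, Real.sin_add_int_mul_two_pi]
  have hi' : (i' : ℝ) = i + m * u := by
    have : i' = i + m * u := by linarith
    exact_mod_cast this
  have hj' : (j' : ℝ) = j + m * v := by
    have : j' = j + m * v := by linarith
    exact_mod_cast this
  have e1 : (2 * (i' : ℝ) + q - k + 1) * θ = (2 * i + q - k + 1) * θ + 2 * (m * u) * θ := by
    rw [hi']; ring
  have e2 : (2 * (j' : ℝ) - k + 1) * θ = (2 * j - k + 1) * θ + 2 * (m * v) * θ := by
    rw [hj']; ring
  rw [facetFun, facetFun, e1, e2, hrot, hrot]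

theorem image_facetVerts_inl {m : ℕ} (q : ℕ) (i : ZMod m) :
    (fun p : ZMod m × ZMod m => fpt m p.1 p.2) '' facetVerts q (.inl i) =
      {x | ∃ j : ZMod m, q ∣ (i - j).val ∧ (x = fpt m i j ∨ x = fpt m (i + 1) (j + 1))} := by
  ext x
  constructor
  · rintro ⟨⟨a, b⟩, ⟨h, rfl | rfl⟩, rfl⟩
    · exact ⟨b, h, Or.inl rfl⟩
    · exact ⟨b - 1, by rwa [sub_sub_eq_add_sub], Or.inr (by simp)⟩
  · rintro ⟨j, h, rfl | rfl⟩
    · exact ⟨(i, j), ⟨h, Or.inl rfl⟩, rfl⟩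
    · exact ⟨(i + 1, j + 1), ⟨by simpa using h, Or.inr rfl⟩, rfl⟩

theorem image_facetVerts_inr_inl {m : ℕ} (q : ℕ) (j : ZMod m) :
    (fun p : ZMod m × ZMod m => fpt m p.1 p.2) '' facetVerts q (.inr (.inl j)) =
      {x | ∃ i : ZMod m, q ∣ (i - j).val ∧ (x = fpt m i j ∨ x = fpt m (i + 1) (j + 1))} := by
  ext x
  constructor
  · rintro ⟨⟨a, b⟩, ⟨h, rfl | rfl⟩, rfl⟩
    · exact ⟨a, h, Or.inl rfl⟩
    · exact ⟨a - 1, by rwa [sub_sub, add_comm 1], Or.inr (by simp)⟩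
  · rintro ⟨i, h, rfl | rfl⟩
    · exact ⟨(i, j), ⟨h, Or.inl rfl⟩, rfl⟩
    · exact ⟨(i + 1, j + 1), ⟨by simpa using h, Or.inr rfl⟩, rfl⟩

section Twisted

variable {d q m : ℕ} [NeZero m] {θ : ℝ}

/-- The vertices of the twisted product. -/
def twistedVerts (m q : ℕ) : Set ℝ⁴ :=
  (fun p : ZMod m × ZMod m => fpt m p.1 p.2) '' {p | q ∣ (p.1 - p.2).val}

/-- The functional supporting the facet with the given label. -/
def facetFunctional (θ : ℝ) (t : FacetIndex m q) : ℝ⁴ →L[ℝ] ℝ :=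
  facetFun θ q (facetBase q t).1.1.val (facetBase q t).1.2.val (facetBase q t).2

theorem fpt_eq_torusPt (hθ : m * θ = π) (a b : ZMod m) :
    fpt m a b = torusPt θ a.val b.val := by
  rw [← fpt_intCast hθ, intCast_val, intCast_val]

theorem torusPt_mem_twistedVerts (hqm : q ∣ m) (hθ : m * θ = π) {X Y : ℤ}
    (h : (q : ℤ) ∣ X - Y) : torusPt θ X Y ∈ twistedVerts m q := by
  refine ⟨(X, Y), ?_, fpt_intCast hθ X Y⟩
  have := (dvd_val_intCast (m := m) hqm _).2 h
  simpa using this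

theorem corners_mem_face (hqm : q ∣ m) (hθ : m * θ = π) {i j : ℤ} (k : ℤ)
    (hij : (q : ℤ) ∣ i - j) {x : ℝ⁴}
    (hx : x = torusPt θ i j ∨ x = torusPt θ (i + 1) (j + 1) ∨
      x = torusPt θ (i + q - k) (j - k) ∨ x = torusPt θ (i + q - k + 1) (j - k + 1)) :
    x ∈ {x ∈ twistedVerts m q | facetFun θ q i j k x = Real.sin (q * θ) * Real.cos θ} := by
  obtain ⟨c0, c1, c2, c3⟩ := facetVal_corners (θ := θ) q k
  rw [Int.cast_natCast] at c0 c1 c2 c3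
  have hij' : (q : ℤ) ∣ i - j + q := Int.dvd_add hij dvd_rfl
  rcases hx with rfl | rfl | rfl | rfl <;>
    refine ⟨torusPt_mem_twistedVerts hqm hθ ?_, ?_⟩
  · exact hij
  · rw [facetFun_torusPt, sub_self, sub_self, c0]
  · convert hij using 1; ring
  · rw [facetFun_torusPt, add_sub_cancel_left, add_sub_cancel_left, c1]
  · convert hij' using 1; ring
  · rw [facetFun_torusPt, ← c2]; congr 1 <;> ring
  · convert hij' using 1; ring
  · rw [facetFun_torusPt, ← c3]; congr 1 <;> ring

theorem facetFunctional_le (hd : 3 ≤ d) (hq : 1 ≤ q) (hm : m = d * q) (hθ : m * θ = π)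
    (t : FacetIndex m q) {x : ℝ⁴} (hx : x ∈ twistedVerts m q) :
    facetFunctional θ t x ≤ Real.sin (q * θ) * Real.cos θ := by
  have hqm : q ∣ m := ⟨d, by rw [hm, mul_comm]⟩
  obtain ⟨⟨a, b⟩, hab, rfl⟩ := hx
  obtain ⟨hk, hkq⟩ := facetBase_mem_Icc t
  dsimp only
  rw [fpt_eq_torusPt hθ, facetFunctional, facetFun_torusPt]
  apply facetVal_le hd hq hm hθ hk hkq
  have h1 := (dvd_val_sub hqm a b).1 hab
  have h2 := (dvd_val_sub hqm _ _).1 (dvd_of_facetBase t)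
  convert Int.dvd_sub h1 h2 using 1
  ring

theorem facetFunctional_eq_iff (hd : 3 ≤ d) (hq : 1 ≤ q) (hm : m = d * q) (hθ : m * θ = π)
    (t : FacetIndex m q) {p : ZMod m × ZMod m} (hp : q ∣ (p.1 - p.2).val) :
    facetFunctional θ t (fpt m p.1 p.2) = Real.sin (q * θ) * Real.cos θ ↔
      p ∈ facetVerts q t := by
  have hqm : q ∣ m := ⟨d, by rw [hm, mul_comm]⟩
  obtain ⟨a, b⟩ := p
  have key : ∀ (x y : ZMod m) (n : ℤ), (m : ℤ) ∣ (x.val : ℤ) - y.val - n ↔ x = y + n := by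
    intro x y n
    rw [← ZMod.intCast_zmod_eq_zero_iff_dvd, sub_sub]
    push_cast
    rw [sub_eq_zero]
    simp
  have key0 : ∀ x y : ZMod m, (m : ℤ) ∣ (x.val : ℤ) - y.val ↔ x = y := by
    intro x y
    simpa using key x y 0
  have key1 : ∀ x y : ZMod m, (m : ℤ) ∣ (x.val : ℤ) - y.val - 1 ↔ x = y + 1 := by
    intro x y
    simpa using key x y 1
  rw [fpt_eq_torusPt hθ, facetFunctional, facetFun_torusPt]
  rcases t with i | j | ⟨⟨⟨i, j⟩, hw⟩, k⟩
  · simp only [facetBase, facetVerts, facetVal_self_eq_iff hd hq hm hθ, key0, key1,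
      Set.mem_ofPred_eq, hp, true_and]
  · simp only [facetBase, facetVerts, facetVal_zero_eq_iff hd hq hm hθ, key0, key1,
      Set.mem_ofPred_eq, hp, true_and]
  · have hdvd : (q : ℤ) ∣ ((a.val : ℤ) - i.val) - (b.val - j.val) := by
      convert Int.dvd_sub ((dvd_val_sub hqm a b).1 hp) ((dvd_val_sub hqm i j).1 hw) using 1
      ring
    have e1 : ∀ n : ℤ, n - (q - ((k : ℤ) + 1)) - 1 = n - (q - k) := fun n => by ring
    have e2 : ∀ n : ℤ, n + ((k : ℤ) + 1) = n - (-(k + 1)) := fun n => by ring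
    have e3 : ∀ n : ℤ, n + ((k : ℤ) + 1) - 1 = n - (-k) := fun n => by ring
    simp only [facetBase]
    rw [(facetVal_interior hd hm hθ (by omega) (by omega) hdvd).2, e1, e3, e2]
    simp only [key0, key1, key, facetVerts, Set.mem_insert_iff, Set.mem_singleton_iff,
      Prod.mk.injEq]
    push_cast
    have f1 : i + ((q : ZMod m) - (k + 1)) = i + q - (k + 1) := by ring
    have f2 : j + (-((k : ZMod m) + 1)) = j - (k + 1) := by ring
    have f3 : i + ((q : ZMod m) - k) = i + q - (k + 1) + 1 := by ring
    have f4 : j + (-(k : ZMod m)) = j - (k + 1) + 1 := by ring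
    rw [f1, f2, f3, f4]

theorem face_eq (hd : 3 ≤ d) (hq : 1 ≤ q) (hm : m = d * q) (hθ : m * θ = π)
    (t : FacetIndex m q) :
    {x ∈ twistedVerts m q | facetFunctional θ t x = Real.sin (q * θ) * Real.cos θ} =
      (fun p : ZMod m × ZMod m => fpt m p.1 p.2) '' facetVerts q t := by
  have hqm : q ∣ m := ⟨d, by rw [hm, mul_comm]⟩
  ext x
  constructor
  · rintro ⟨⟨p, hp, rfl⟩, hx⟩
    exact ⟨p, (facetFunctional_eq_iff hd hq hm hθ t hp).1 hx, rfl⟩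
  · rintro ⟨p, hp, rfl⟩
    have hp' := dvd_of_mem_facetVerts hqm hp
    exact ⟨⟨p, hp', rfl⟩, (facetFunctional_eq_iff hd hq hm hθ t hp').2 hp⟩

theorem face_injective (hd : 3 ≤ d) (hq : 1 ≤ q) (hm : m = d * q) (hθ : m * θ = π) :
    Function.Injective fun t : FacetIndex m q =>
      {x ∈ twistedVerts m q | facetFunctional θ t x = Real.sin (q * θ) * Real.cos θ} := by
  have hqm : q ∣ m := ⟨d, by rw [hm, mul_comm]⟩
  have hsub : ∀ t t' : FacetIndex m q,
      {x ∈ twistedVerts m q | facetFunctional θ t x = Real.sin (q * θ) * Real.cos θ} =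
      {x ∈ twistedVerts m q | facetFunctional θ t' x = Real.sin (q * θ) * Real.cos θ} →
      facetVerts q t ⊆ facetVerts q t' := by
    intro t t' h p hp
    have hp' := dvd_of_mem_facetVerts hqm hp
    have := (Set.ext_iff.1 h (fpt m p.1 p.2)).1
      ⟨⟨p, hp', rfl⟩, (facetFunctional_eq_iff hd hq hm hθ t hp').2 hp⟩
    exact (facetFunctional_eq_iff hd hq hm hθ t' hp').1 this.2
  intro t t' h
  exact facetVerts_injective hd hq hm (Set.Subset.antisymm (hsub _ _ h) (hsub _ _ h.symm))

theorem exists_linearIndependent_face (hd : 3 ≤ d) (hq : 1 ≤ q) (hm : m = d * q) (hθ : m * θ = π)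
    (t : FacetIndex m q) : ∃ v : Fin 4 → ℝ⁴, LinearIndependent ℝ v ∧
      ∀ n, v n ∈ twistedVerts m q ∧
        facetFunctional θ t (v n) = Real.sin (q * θ) * Real.cos θ := by
  have hqm : q ∣ m := ⟨d, by rw [hm, mul_comm]⟩
  have hd' : (3 : ℝ) ≤ d := by exact_mod_cast hd
  have hq' : (1 : ℝ) ≤ q := by exact_mod_cast hq
  have hm' : (m : ℝ) = d * q := by exact_mod_cast hm
  have hθ0 : 0 < θ := pos_of_mul_pos_right (hθ ▸ Real.pi_pos : 0 < m * θ) (by positivity)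
  have hδ : 3 * (q * θ) ≤ π := by
    rw [← hθ, hm', mul_assoc]
    exact mul_le_mul_of_nonneg_right hd' (by positivity)
  have hqθ : θ ≤ q * θ := by nlinarith
  have hs1 : Real.sin (2 * θ) ≠ 0 :=
    (Real.sin_pos_of_pos_of_lt_pi (by positivity) (by linarith)).ne'
  have hs2 : Real.sin (2 * (q : ℤ) * θ) ≠ 0 := by
    rw [Int.cast_natCast, mul_assoc]
    exact (Real.sin_pos_of_pos_of_lt_pi (by positivity) (by linarith)).ne'
  have hij := (dvd_val_sub hqm _ _).1 (dvd_of_facetBase t)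
  refine ⟨_, linearIndependent_torusPt hs1 hs2 (facetBase q t).1.1.val
    (facetBase q t).1.2.val (facetBase q t).2, fun n =>
    corners_mem_face hqm hθ (facetBase q t).2 hij ?_⟩
  fin_cases n <;> simp

theorem exists_mem_face_cone (hd : 3 ≤ d) (hq : 1 ≤ q) (hm : m = d * q) (hθ : m * θ = π)
    (x : ℝ⁴) : ∃ t : FacetIndex m q, x ∈ Submodule.span ℝ≥0
      {x ∈ twistedVerts m q | facetFunctional θ t x = Real.sin (q * θ) * Real.cos θ} := by
  have hqm : q ∣ m := ⟨d, by rw [hm, mul_comm]⟩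
  have hδ : d * (((q : ℤ) : ℝ) * θ) = π := by rw [← hθ, hm]; push_cast; ring
  have hm0 : (0 : ℝ) < m := Nat.cast_pos.2 (NeZero.pos m)
  have hθ0 : 0 < θ := pos_of_mul_pos_right (hθ ▸ Real.pi_pos : 0 < m * θ) hm0.le
  obtain ⟨i, j, k, hk, hkq, hij, hx⟩ := exists_mem_cone hd hδ (by omega) hθ0
    (fun i j k => Submodule.span ℝ≥0
      {x ∈ twistedVerts m q | facetFun θ q i j k x = Real.sin (q * θ) * Real.cos θ})
    (fun i j k _ _ hij => ⟨Submodule.subset_span (corners_mem_face hqm hθ k hij (by simp)),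
      Submodule.subset_span (corners_mem_face hqm hθ k hij (by simp)),
      Submodule.subset_span (corners_mem_face hqm hθ k hij (by simp)),
      Submodule.subset_span (corners_mem_face hqm hθ k hij (by simp))⟩)
    (fun s t => by
      rw [facetFun_zero θ q s (s + q * t) s]
      have h : (q : ℤ) ∣ s + q * t - s := by simp
      exact ⟨Submodule.subset_span (corners_mem_face hqm hθ 0 h (by simp)),
        Submodule.subset_span (corners_mem_face hqm hθ 0 h (by simp))⟩)
    (fun s t => by
      rw [facetFun_self θ q s s (s + q * t)]
      have h : (q : ℤ) ∣ s - (s + q * t) := by simp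
      exact ⟨Submodule.subset_span (corners_mem_face hqm hθ q h (by simp)),
        Submodule.subset_span (corners_mem_face hqm hθ q h (by simp))⟩) x
  suffices h : ∃ t : FacetIndex m q, facetFunctional θ t = facetFun θ q i j k by
    obtain ⟨t, ht⟩ := h
    exact ⟨t, by rw [ht]; exact hx⟩
  rcases hk.eq_or_lt with rfl | hk
  · refine ⟨.inr (.inl j), ?_⟩
    rw [facetFun_zero θ q i j j]
    exact facetFun_congr hθ q 0 (intCast_val _) (intCast_val _)
  rcases hkq.eq_or_lt with rfl | hkq
  · refine ⟨.inl i, ?_⟩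
    rw [facetFun_self θ q i j i]
    exact facetFun_congr hθ q q (intCast_val _) (intCast_val _)
  · lift k to ℕ using hk.le
    have hw := (dvd_val_intCast (m := m) hqm _).2 hij
    rw [Int.cast_sub] at hw
    refine ⟨.inr (.inr (⟨(i, j), hw⟩, ⟨k - 1, by omega⟩)), ?_⟩
    have e : ((k - 1 : ℕ) : ℤ) + 1 = k := by omega
    rw [facetFunctional, facetBase, e]
    exact facetFun_congr hθ q k (intCast_val _) (intCast_val _)

theorem card_facetIndex (hq : 1 ≤ q) (hm : m = d * q) :
    Fintype.card (FacetIndex m q) = m * (m - d + 2) := by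
  have hdm : d ≤ m := by rw [hm]; exact Nat.le_mul_of_pos_right d hq
  rw [Fintype.card_sum, Fintype.card_sum, Fintype.card_prod, ZMod.card, Fintype.card_fin,
    Fintype.card_subtype, card_index hq hm]
  zify [hq, hdm]
  have : (m : ℤ) = d * q := by exact_mod_cast hm
  linear_combination -(m : ℤ) * this

end Twisted

/-- For `d ≥ 3`, `q ≥ 1`, `m = dq`, the index set
`W = {(i,j) ∈ (ℤ/mℤ)² : i ≡ j (mod q)}` has exactly `m·d` elements, and the
twisted product `P_{d,q} = conv f(W)` has exactly `m(m−d+2)` facets: the `m`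
vertical facets, the `m` horizontal facets, and the `md(q−1)` diagonal
tetrahedra described below. -/
theorem stmt17 (d q : ℕ) (hd : 3 ≤ d) (hq : 1 ≤ q) (m : ℕ) [NeZero m] (hm : m = d * q)
    (W : Finset (ZMod m × ZMod m))
    (hW : W = Finset.univ.filter (fun p : ZMod m × ZMod m => q ∣ (p.1 - p.2).val))
    (P : Set (EuclideanSpace ℝ (Fin 4)))
    (hP : P = convexHull ℝ ((fun p : ZMod m × ZMod m => fpt m p.1 p.2) '' (W : Set (ZMod m × ZMod m)))) :
    W.card = m * d ∧
    -- the m vertical facets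
    (∀ i : ZMod m, IsFacet P (convexHull ℝ
      {x | ∃ j : ZMod m, q ∣ (i - j).val ∧ (x = fpt m i j ∨ x = fpt m (i + 1) (j + 1))})) ∧
    -- the m horizontal facets
    (∀ j : ZMod m, IsFacet P (convexHull ℝ
      {x | ∃ i : ZMod m, q ∣ (i - j).val ∧ (x = fpt m i j ∨ x = fpt m (i + 1) (j + 1))})) ∧
    -- the md(q−1) diagonal tetrahedra
    (∀ i j : ZMod m, q ∣ (i - j).val → ∀ k : ℕ, 1 ≤ k → k ≤ q - 1 →
      IsFacet P (convexHull ℝ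
        ({fpt m i j, fpt m (i + 1) (j + 1),
          fpt m (i + (q : ZMod m) - (k : ZMod m)) (j - (k : ZMod m)),
          fpt m (i + (q : ZMod m) - (k : ZMod m) + 1) (j - (k : ZMod m) + 1)} :
            Set (EuclideanSpace ℝ (Fin 4))))) ∧
    -- and these are all the facets: there are exactly m(m−d+2) of them
    {F : Set (EuclideanSpace ℝ (Fin 4)) | IsFacet P F}.ncard = m * (m - d + 2) := by
  set θ : ℝ := π / m
  have hm0 : (m : ℝ) ≠ 0 := Nat.cast_ne_zero.2 (NeZero.ne m)
  have hθ : m * θ = π := mul_div_cancel₀ π hm0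
  have hP' : P = convexHull ℝ (twistedVerts m q) := by
    rw [hP, hW, Finset.coe_filter]
    simp [twistedVerts]
  have hm3 : (3 : ℝ) ≤ m := by
    have : 3 ≤ m := by rw [hm]; nlinarith
    exact_mod_cast this
  have hc : 0 < Real.sin (q * θ) * Real.cos θ := by
    refine mul_pos (sin_facet_pos hd hq hm hθ) (Real.cos_pos_of_mem_Ioo ⟨?_, ?_⟩) <;>
      nlinarith [Real.pi_pos]
  have hfin : (twistedVerts m q).Finite := (Set.toFinite _).image _
  have hle : ∀ t : FacetIndex m q, ∀ x ∈ twistedVerts m q,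
      facetFunctional θ t x ≤ Real.sin (q * θ) * Real.cos θ :=
    fun t x hx => facetFunctional_le hd hq hm hθ t hx
  have hfacet : ∀ t : FacetIndex m q, IsFacet P (convexHull ℝ
      ((fun p : ZMod m × ZMod m => fpt m p.1 p.2) '' facetVerts q t)) := fun t => by
    rw [hP', ← face_eq hd hq hm hθ, isFacet_iff_of_cover hfin hc hle
      (exists_linearIndependent_face hd hq hm hθ) (exists_mem_face_cone hd hq hm hθ)]
    exact ⟨t, rfl⟩
  refine ⟨hW ▸ card_index hq hm, fun i => ?_, fun j => ?_, fun i j hij k hk hkq => ?_, ?_⟩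
  · rw [← image_facetVerts_inl]
    exact hfacet _
  · rw [← image_facetVerts_inr_inl]
    exact hfacet _
  · convert hfacet (.inr (.inr (⟨(i, j), hij⟩, ⟨k - 1, by omega⟩))) using 2
    simp [facetVerts, Set.image_insert_eq, Nat.sub_add_cancel hk, -Nat.cast_add]
  · rw [hP', ncard_facets_of_cover hfin hc hle (exists_linearIndependent_face hd hq hm hθ)
      (exists_mem_face_cone hd hq hm hθ) (face_injective hd hq hm hθ), card_facetIndex hq hm]
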